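/- arXiv:1308.6559 — 3 statements merged into one kernel-verified Lean document; each statement's English description precedes it below -/
import Mathlib

section
/- Let (φ1, φ2) be an admissible nondecreasing pair, let 0 < m1 ≤ m2 be reals, let α ∈ [0,1], and set n = α·m1 + (1−α)·m2 and φ = α·φ1 + (1−α)·φ2. Then for every x ∈ ℝ and every t ∈ [0,1], F_{φ,n}(x,t) ≤ α·F_{φ1,m1}(x,t) + (1−α)·F_{φ2,m2}(x,t). -/
open MeasureTheory ProbabilityTheory Set

/-- `parisiF φ m x t = (1/m) log E[exp (m φ(x + √t Z))]` with `Z` standard Gaussian. -/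
noncomputable def parisiF (φ : ℝ → ℝ) (m : ℝ) (x t : ℝ) : ℝ :=
  (1 / m) * Real.log (∫ z, Real.exp (m * φ (x + Real.sqrt t * z)) ∂(gaussianReal 0 1))

/-- `φ` is twice differentiable with bounded first and second derivatives. -/
def TwiceDiffBounded (φ : ℝ → ℝ) : Prop :=
  Differentiable ℝ φ ∧ Differentiable ℝ (deriv φ) ∧
    (∃ C, ∀ x, |deriv φ x| ≤ C) ∧ (∃ C, ∀ x, |deriv (deriv φ) x| ≤ C)

/-- An admissible nondecreasing pair. -/
def AdmissibleNondecPair (φ1 φ2 : ℝ → ℝ) : Prop :=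
  TwiceDiffBounded φ1 ∧ TwiceDiffBounded φ2 ∧
    Monotone φ1 ∧ Monotone φ2 ∧
    ConvexOn ℝ Set.univ φ1 ∧ ConvexOn ℝ Set.univ φ2 ∧
    (∀ x, φ1 x ≤ φ2 x) ∧ (∀ x, deriv φ1 x ≤ deriv φ2 x)

/-- `f` is Lipschitz with the real constant `L`. -/
def RealLipschitz (L : ℝ) (f : ℝ → ℝ) : Prop :=
  ∀ x y, |f x - f y| ≤ L * |x - y|

namespace RealLipschitz

variable {L M : ℝ} {f g : ℝ → ℝ}

theorem continuous (hf : RealLipschitz L f) : Continuous f := by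
  have : LipschitzWith L.toNNReal f := by
    refine LipschitzWith.of_dist_le_mul fun x y => ?_
    rw [Real.dist_eq, Real.dist_eq]
    exact (hf x y).trans (mul_le_mul_of_nonneg_right (Real.le_coe_toNNReal L) (abs_nonneg _))
  exact this.continuous

theorem add (hf : RealLipschitz L f) (hg : RealLipschitz M g) :
    RealLipschitz (L + M) (fun x => f x + g x) := fun x y => by
  have h := abs_add_le (f x - f y) (g x - g y)
  rw [show f x + g x - (f y + g y) = (f x - f y) + (g x - g y) by ring]
  linarith [hf x y, hg x y]

theorem const_mul (hf : RealLipschitz L f) (c : ℝ) :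
    RealLipschitz (|c| * L) (fun x => c * f x) := fun x y => by
  rw [← mul_sub, abs_mul, mul_assoc]
  exact mul_le_mul_of_nonneg_left (hf x y) (abs_nonneg c)

theorem sub (hf : RealLipschitz L f) (hg : RealLipschitz M g) :
    RealLipschitz (L + M) (fun x => f x - g x) := fun x y => by
  have h := abs_sub (f x - f y) (g x - g y)
  rw [show f x - g x - (f y - g y) = (f x - f y) - (g x - g y) by ring]
  linarith [hf x y, hg x y]

theorem sub_const (hf : RealLipschitz L f) (c : ℝ) :
    RealLipschitz L (fun x => f x - c) := fun x y => by
  simpa using hf x y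

theorem comp_affine (hf : RealLipschitz L f) (x a : ℝ) :
    RealLipschitz (L * |a|) (fun z => f (x + a * z)) := fun y z => by
  have h := hf (x + a * y) (x + a * z)
  rwa [show x + a * y - (x + a * z) = a * (y - z) by ring, abs_mul, ← mul_assoc] at h

theorem abs_le (hf : RealLipschitz L f) (z : ℝ) : |f z| ≤ |f 0| + L * |z| := by
  have h := hf z 0
  have h' := abs_sub_abs_le_abs_sub (f z) (f 0)
  rw [sub_zero] at h
  linarith

end RealLipschitz

theorem integrable_exp_const_mul_abs_gaussianReal (B : ℝ) :
    Integrable (fun z => Real.exp (B * |z|)) (gaussianReal 0 1) := by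
  refine ((integrable_exp_mul_gaussianReal B).add (integrable_exp_mul_gaussianReal (-B))).mono'
    (by fun_prop) (Filter.Eventually.of_forall fun z => ?_)
  rw [Real.norm_eq_abs, abs_of_pos (Real.exp_pos _), Pi.add_apply]
  rcases abs_cases z with ⟨h, -⟩ | ⟨h, -⟩ <;> rw [h]
  · linarith [Real.exp_pos (-B * z)]
  · rw [show B * -z = -B * z by ring]
    linarith [Real.exp_pos (B * z)]

theorem integrable_gaussianReal_of_abs_le_exp {g : ℝ → ℝ} (hg : Continuous g) (A B : ℝ)
    (h : ∀ z, |g z| ≤ Real.exp (A + B * |z|)) : Integrable g (gaussianReal 0 1) := by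
  refine ((integrable_exp_const_mul_abs_gaussianReal B).const_mul (Real.exp A)).mono'
    hg.aestronglyMeasurable (Filter.Eventually.of_forall fun z => ?_)
  rw [Real.norm_eq_abs, ← Real.exp_add]
  exact h z

namespace RealLipschitz

variable {L M : ℝ} {f g : ℝ → ℝ}

theorem abs_le_exp (hf : RealLipschitz L f) (z : ℝ) : |f z| ≤ Real.exp (|f 0| + L * |z|) := by
  linarith [hf.abs_le z, Real.add_one_le_exp (|f 0| + L * |z|)]

theorem integrable (hf : RealLipschitz L f) : Integrable f (gaussianReal 0 1) :=
  integrable_gaussianReal_of_abs_le_exp hf.continuous _ _ hf.abs_le_exp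

theorem integrable_mul (hf : RealLipschitz L f) (hg : RealLipschitz M g) :
    Integrable (fun z => f z * g z) (gaussianReal 0 1) := by
  refine integrable_gaussianReal_of_abs_le_exp (hf.continuous.mul hg.continuous)
    (|f 0| + |g 0|) (L + M) fun z => ?_
  rw [abs_mul, show |f 0| + |g 0| + (L + M) * |z| = (|f 0| + L * |z|) + (|g 0| + M * |z|) by ring,
    Real.exp_add]
  exact mul_le_mul (hf.abs_le_exp z) (hg.abs_le_exp z) (abs_nonneg _) (Real.exp_pos _).le

theorem integrable_sq (hf : RealLipschitz L f) :
    Integrable (fun z => f z ^ 2) (gaussianReal 0 1) := by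
  simpa only [sq] using hf.integrable_mul hf

theorem integrable_exp (hf : RealLipschitz L f) :
    Integrable (fun z => Real.exp (f z)) (gaussianReal 0 1) := by
  refine integrable_gaussianReal_of_abs_le_exp (Real.continuous_exp.comp hf.continuous)
    |f 0| L fun z => ?_
  rw [abs_of_pos (Real.exp_pos _)]
  exact Real.exp_le_exp.2 ((le_abs_self _).trans (hf.abs_le z))

theorem integral_exp_pos (hf : RealLipschitz L f) :
    0 < ∫ z, Real.exp (f z) ∂(gaussianReal 0 1) :=
  MeasureTheory.integral_exp_pos hf.integrable_exp

end RealLipschitz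

/-- Chebyshev's association inequality for two nondecreasing functions and a weight. -/
theorem integral_mul_integral_le_of_monotone {μ : Measure ℝ} [SFinite μ] {w f g : ℝ → ℝ}
    (hw : ∀ z, 0 ≤ w z) (hf : Monotone f) (hg : Monotone g) (iw : Integrable w μ)
    (iwf : Integrable (fun z => w z * f z) μ) (iwg : Integrable (fun z => w z * g z) μ)
    (iwfg : Integrable (fun z => w z * f z * g z) μ) :
    (∫ z, w z * f z ∂μ) * (∫ z, w z * g z ∂μ) ≤ (∫ z, w z * f z * g z ∂μ) * ∫ z, w z ∂μ := by
  have h0 : 0 ≤ ∫ p : ℝ × ℝ, w p.1 * w p.2 * ((f p.1 - f p.2) * (g p.1 - g p.2)) ∂(μ.prod μ) := by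
    refine integral_nonneg fun p => mul_nonneg (mul_nonneg (hw _) (hw _)) ?_
    rcases le_total p.1 p.2 with h | h
    · exact mul_nonneg_of_nonpos_of_nonpos (sub_nonpos.2 (hf h)) (sub_nonpos.2 (hg h))
    · exact mul_nonneg (sub_nonneg.2 (hf h)) (sub_nonneg.2 (hg h))
  have e : (fun p : ℝ × ℝ => w p.1 * w p.2 * ((f p.1 - f p.2) * (g p.1 - g p.2))) =
      fun p => (w p.1 * f p.1 * g p.1) * w p.2 - (w p.1 * f p.1) * (w p.2 * g p.2)
        - (w p.1 * g p.1) * (w p.2 * f p.2) + w p.1 * (w p.2 * f p.2 * g p.2) := by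
    funext p; ring
  have i1 := iwfg.mul_prod iw
  have i2 := iwf.mul_prod iwg
  have i3 := iwg.mul_prod iwf
  have i4 := iw.mul_prod iwfg
  have i12 : Integrable (fun p : ℝ × ℝ => (w p.1 * f p.1 * g p.1) * w p.2
      - (w p.1 * f p.1) * (w p.2 * g p.2)) (μ.prod μ) := i1.sub i2
  have i123 : Integrable (fun p : ℝ × ℝ => (w p.1 * f p.1 * g p.1) * w p.2
      - (w p.1 * f p.1) * (w p.2 * g p.2) - (w p.1 * g p.1) * (w p.2 * f p.2)) (μ.prod μ) :=
    i12.sub i3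
  rw [e, integral_add i123 i4, integral_sub i12 i3, integral_sub i1 i2,
    integral_prod_mul (fun z => w z * f z * g z) w,
    integral_prod_mul (fun z => w z * f z) (fun z => w z * g z),
    integral_prod_mul (fun z => w z * g z) (fun z => w z * f z),
    integral_prod_mul w (fun z => w z * f z * g z)] at h0
  linarith

theorem abs_exp_sub_quadratic_le (u : ℝ) :
    |Real.exp u - 1 - u - u ^ 2 / 2| ≤ |u| ^ 3 * Real.exp |u| := by
  have h := Complex.norm_exp_sub_sum_le_norm_mul_exp (u : ℂ) 3
  simp only [Finset.sum_range_succ, Finset.sum_range_zero] at h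
  rw [Complex.norm_real, Real.norm_eq_abs] at h
  rw [← Real.norm_eq_abs (Real.exp u - 1 - u - u ^ 2 / 2), ← Complex.norm_real]
  refine le_trans (le_of_eq ?_) h
  congr 1
  push_cast
  norm_num [Nat.factorial]
  ring

theorem abs_exp_sub_quadratic_le_of_abs_le {a σ w u : ℝ} (ha : 0 ≤ a) (hσ : 0 ≤ σ) (hσ1 : σ ≤ 1)
    (hw : 0 ≤ w) (hu : |u| ≤ a * σ * w) :
    |Real.exp u - 1 - u - u ^ 2 / 2| ≤ 6 * a ^ 3 * σ ^ 3 * Real.exp ((a + 1) * w) := by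
  have hu' : |u| ≤ a * w := hu.trans (by
    have := mul_le_mul_of_nonneg_right (mul_le_of_le_one_right ha hσ1) hw
    linarith)
  have h3 := Real.pow_div_factorial_le_exp w hw 3
  norm_num [Nat.factorial] at h3
  calc _ ≤ |u| ^ 3 * Real.exp |u| := abs_exp_sub_quadratic_le u
    _ ≤ (a * σ * w) ^ 3 * Real.exp (a * w) := by gcongr
    _ = a ^ 3 * σ ^ 3 * (w ^ 3 * Real.exp (a * w)) := by ring
    _ ≤ a ^ 3 * σ ^ 3 * ((6 * Real.exp w) * Real.exp (a * w)) := by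
        gcongr
        linarith
    _ = _ := by
        rw [show (a + 1) * w = w + a * w by ring, Real.exp_add]
        ring

theorem RealLipschitz.abs_sub_integral_le {L : ℝ} {f : ℝ → ℝ} (hf : RealLipschitz L f) (z : ℝ) :
    |f z - ∫ y, f y ∂(gaussianReal 0 1)| ≤ L * (|z| + ∫ y, |y| ∂(gaussianReal 0 1)) := by
  have hL : 0 ≤ L := by
    have := (abs_nonneg _).trans (hf 1 0)
    simpa using this
  have iabs : Integrable (fun y : ℝ => |y|) (gaussianReal 0 1) :=
    RealLipschitz.integrable (L := 1) fun x y => by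
      rw [one_mul]; exact abs_abs_sub_abs_le_abs_sub x y
  have e : f z - ∫ y, f y ∂(gaussianReal 0 1) = ∫ y, (f z - f y) ∂(gaussianReal 0 1) := by
    rw [integral_sub (integrable_const _) hf.integrable]
    simp
  have e' : L * (|z| + ∫ y, |y| ∂(gaussianReal 0 1)) =
      ∫ y, L * (|z| + |y|) ∂(gaussianReal 0 1) := by
    rw [integral_const_mul, integral_add (integrable_const _) iabs]
    simp
  rw [e, e']
  refine (abs_integral_le_integral_abs).trans (integral_mono
    ((integrable_const _).sub hf.integrable).abs
    (((integrable_const _).add iabs).const_mul L) fun y => ?_)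
  exact (hf z y).trans (mul_le_mul_of_nonneg_left (abs_sub z y) hL)

/-- Second-order cumulant expansion of the log-Laplace transform, with a uniform cubic error. -/
theorem exists_abs_log_integral_exp_sub_le {L m : ℝ} (hL : 0 ≤ L) (hm : 0 < m) :
    ∃ C, ∀ σ, 0 ≤ σ → σ ≤ 1 → ∀ f, RealLipschitz (L * σ) f →
      |(1 / m) * Real.log (∫ z, Real.exp (m * f z) ∂(gaussianReal 0 1))
          - (∫ z, f z ∂(gaussianReal 0 1))
          - m / 2 * ∫ z, (f z - ∫ y, f y ∂(gaussianReal 0 1)) ^ 2 ∂(gaussianReal 0 1)|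
        ≤ C * σ ^ 3 := by
  set γ := gaussianReal 0 1
  set K := ∫ y, |y| ∂γ
  have hK : 0 ≤ K := integral_nonneg fun y => abs_nonneg y
  have wl : RealLipschitz 1 (fun z : ℝ => |z| + K) := fun x y => by
    rw [one_mul, add_sub_add_right_eq_sub]; exact abs_abs_sub_abs_le_abs_sub x y
  set a := m * L
  have ha : 0 ≤ a := mul_nonneg hm.le hL
  set C₁ := 6 * a ^ 3 * ∫ z, Real.exp ((a + 1) * (|z| + K)) ∂γ
  have hC₁ : 0 ≤ C₁ := mul_nonneg (by positivity) (integral_nonneg fun z => (Real.exp_pos _).le)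
  set K₂ := ∫ z, (|z| + K) ^ 2 ∂γ
  have hK₂ : 0 ≤ K₂ := integral_nonneg fun z => sq_nonneg _
  set C₂ := C₁ + a ^ 2 / 2 * K₂
  refine ⟨(C₁ + C₂ ^ 2) / m, fun σ hσ hσ1 f hf => ?_⟩
  set c := ∫ y, f y ∂γ with hc
  set V := ∫ z, (f z - c) ^ 2 ∂γ
  have hX : ∀ z, |f z - c| ≤ L * σ * (|z| + K) := fun z => hf.abs_sub_integral_le z
  have Xl : RealLipschitz (L * σ) (fun z => f z - c) := hf.sub_const c
  have mXl := Xl.const_mul m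
  have hu : ∀ z, |m * (f z - c)| ≤ a * σ * (|z| + K) := fun z => by
    rw [abs_mul, abs_of_pos hm]
    have := mul_le_mul_of_nonneg_left (hX z) hm.le
    simp only [a]; linarith
  have EX : ∫ z, (f z - c) ∂γ = 0 := by
    rw [integral_sub hf.integrable (integrable_const _), ← hc]; simp
  have hVle : V ≤ (L * σ) ^ 2 * K₂ := by
    rw [← integral_const_mul]
    refine integral_mono Xl.integrable_sq (wl.integrable_sq.const_mul _) fun z => ?_
    change (f z - c) ^ 2 ≤ (L * σ) ^ 2 * (|z| + K) ^ 2
    rw [← mul_pow, ← sq_abs]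
    exact pow_le_pow_left₀ (abs_nonneg _) (hX z) 2
  set I := ∫ z, Real.exp (m * (f z - c)) ∂γ with hI
  have hlog : Real.log (∫ z, Real.exp (m * f z) ∂γ) = m * c + Real.log I := by
    have : ∀ z, Real.exp (m * f z) = Real.exp (m * c) * Real.exp (m * (f z - c)) := fun z => by
      rw [← Real.exp_add]; congr 1; ring
    simp_rw [this]
    rw [integral_const_mul, Real.log_mul (Real.exp_pos _).ne' mXl.integral_exp_pos.ne',
      Real.log_exp]
  have hy : I - 1 - m ^ 2 / 2 * V = ∫ z, (Real.exp (m * (f z - c)) - 1 - m * (f z - c)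
      - (m * (f z - c)) ^ 2 / 2) ∂γ := by
    have i1 := mXl.integrable_exp
    have i2 : Integrable (fun _ : ℝ => (1 : ℝ)) γ := integrable_const _
    have i3 := mXl.integrable
    have i4 := mXl.integrable_sq.div_const 2
    have i12 : Integrable (fun z => Real.exp (m * (f z - c)) - 1) γ := i1.sub i2
    have i123 : Integrable (fun z => Real.exp (m * (f z - c)) - 1 - m * (f z - c)) γ := i12.sub i3
    rw [integral_sub i123 i4, integral_sub i12 i3, integral_sub i1 i2,
      integral_const_mul, EX, integral_div]
    simp_rw [mul_pow]
    rw [integral_const_mul]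
    simp [γ]
    ring
  have hy1 : |I - 1 - m ^ 2 / 2 * V| ≤ C₁ * σ ^ 3 := by
    rw [hy]
    refine (abs_integral_le_integral_abs).trans ?_
    rw [show C₁ * σ ^ 3 = ∫ z, 6 * a ^ 3 * σ ^ 3 * Real.exp ((a + 1) * (|z| + K)) ∂γ by
      rw [integral_const_mul]; ring]
    refine integral_mono (((((mXl.integrable_exp).sub (integrable_const _)).sub
      mXl.integrable).sub (mXl.integrable_sq.div_const 2)).abs)
      ((wl.const_mul (a + 1)).integrable_exp.const_mul _) fun z => ?_
    exact abs_exp_sub_quadratic_le_of_abs_le ha hσ hσ1 (by positivity) (hu z)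
  have hI1 : 1 ≤ I := by
    have h : ∫ z, (m * (f z - c) + 1) ∂γ ≤ I :=
      integral_mono (mXl.integrable.add (integrable_const _)) mXl.integrable_exp
        fun z => Real.add_one_le_exp _
    rw [integral_add mXl.integrable (integrable_const _), integral_const_mul, EX] at h
    simpa [γ] using h
  have hσ3 : σ ^ 3 ≤ σ ^ 2 := pow_le_pow_of_le_one hσ hσ1 (by norm_num)
  have hσ4 : σ ^ 4 ≤ σ ^ 3 := pow_le_pow_of_le_one hσ hσ1 (by norm_num)
  have hy2 : I - 1 ≤ C₂ * σ ^ 2 := by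
    have h1 := (abs_le.1 hy1).2
    have h2 := mul_le_mul_of_nonneg_left hVle (by positivity : 0 ≤ m ^ 2 / 2)
    have h3 := mul_le_mul_of_nonneg_left hσ3 hC₁
    have e : m ^ 2 / 2 * ((L * σ) ^ 2 * K₂) = a ^ 2 / 2 * K₂ * σ ^ 2 := by simp only [a]; ring
    simp only [C₂]
    rw [e] at h2
    linarith
  have hsq : (I - 1) ^ 2 ≤ C₂ ^ 2 * σ ^ 3 := by
    have h1 := pow_le_pow_left₀ (sub_nonneg.2 hI1) hy2 2
    have h2 := mul_le_mul_of_nonneg_left hσ4 (sq_nonneg C₂)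
    linarith [show (C₂ * σ ^ 2) ^ 2 = C₂ ^ 2 * σ ^ 4 by ring]
  have hI0 : 0 < I := by linarith
  have hlogu : Real.log I ≤ I - 1 := Real.log_le_sub_one_of_pos hI0
  have hlogl : I - 1 - (I - 1) ^ 2 ≤ Real.log I := by
    refine le_trans ?_ (Real.one_sub_inv_le_log_of_pos hI0)
    rw [← sub_nonneg]
    have e : 1 - I⁻¹ - (I - 1 - (I - 1) ^ 2) = (I - 1) ^ 3 / I := by field_simp; ring
    rw [e]
    have : 0 ≤ I - 1 := by linarith
    positivity
  have e : 1 / m * (m * c + Real.log I) - c - m / 2 * V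
      = (Real.log I - m ^ 2 / 2 * V) / m := by field_simp; ring
  rw [hlog, e, abs_div, abs_of_pos hm, div_mul_eq_mul_div (C₁ + C₂ ^ 2)]
  refine div_le_div_of_nonneg_right ?_ hm.le
  rw [abs_le] at hy1 ⊢
  have : 0 ≤ C₂ ^ 2 * σ ^ 3 := by positivity
  constructor <;> linarith [hy1.1, hy1.2]

section parisiF

variable {φ ψ φ1 φ2 : ℝ → ℝ} {L M m m1 m2 : ℝ}

theorem RealLipschitz.mul_comp_affine (hφ : RealLipschitz L φ) (m x a : ℝ) :
    RealLipschitz (|m| * (L * |a|)) (fun z => m * φ (x + a * z)) :=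
  (hφ.comp_affine x a).const_mul m

theorem exp_mul_parisiF (hφ : RealLipschitz L φ) (hm : 0 < m) (x t : ℝ) :
    Real.exp (m * parisiF φ m x t) =
      ∫ z, Real.exp (m * φ (x + Real.sqrt t * z)) ∂(gaussianReal 0 1) := by
  rw [parisiF, ← mul_assoc, mul_one_div_cancel hm.ne', one_mul,
    Real.exp_log (hφ.mul_comp_affine m x _).integral_exp_pos]

theorem parisiF_zero (φ : ℝ → ℝ) (hm : 0 < m) (x : ℝ) : parisiF φ m x 0 = φ x := by
  simp [parisiF, hm.ne']

theorem parisiF_le_parisiF (hφ : RealLipschitz L φ) (hψ : RealLipschitz M ψ) (hm : 0 < m)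
    {x y : ℝ} (t : ℝ)
    (h : ∀ z, φ (x + Real.sqrt t * z) ≤ ψ (y + Real.sqrt t * z)) :
    parisiF φ m x t ≤ parisiF ψ m y t := by
  refine mul_le_mul_of_nonneg_left (Real.log_le_log (hφ.mul_comp_affine m x _).integral_exp_pos
    (integral_mono (hφ.mul_comp_affine m x _).integrable_exp
      (hψ.mul_comp_affine m y _).integrable_exp fun z => ?_)) (by positivity)
  exact Real.exp_le_exp.2 (mul_le_mul_of_nonneg_left (h z) hm.le)

theorem parisiF_add_const (hφ : RealLipschitz L φ) (hm : 0 < m) (x t c : ℝ) :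
    parisiF (fun y => φ y + c) m x t = parisiF φ m x t + c := by
  have h : ∀ z, Real.exp (m * (φ (x + Real.sqrt t * z) + c)) =
      Real.exp (m * c) * Real.exp (m * φ (x + Real.sqrt t * z)) := fun z => by
    rw [← Real.exp_add]; congr 1; ring
  simp only [parisiF, h]
  rw [integral_const_mul, Real.log_mul (Real.exp_pos _).ne'
    (hφ.mul_comp_affine m x _).integral_exp_pos.ne', Real.log_exp]
  field_simp
  ring

theorem RealLipschitz.add_const (hφ : RealLipschitz L φ) (c : ℝ) :
    RealLipschitz L (fun x => φ x + c) := by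
  simpa only [sub_neg_eq_add] using hφ.sub_const (-c)

theorem RealLipschitz.parisiF (hφ : RealLipschitz L φ) (hm : 0 < m) (t : ℝ) :
    RealLipschitz L (fun x => parisiF φ m x t) := by
  have key : ∀ x y, _root_.parisiF φ m x t ≤ _root_.parisiF φ m y t + L * |x - y| := fun x y => by
    rw [← parisiF_add_const hφ hm]
    refine parisiF_le_parisiF hφ (hφ.add_const _) hm t fun z => ?_
    have h := (le_abs_self _).trans (hφ (x + Real.sqrt t * z) (y + Real.sqrt t * z))
    rw [add_sub_add_right_eq_sub] at h
    linarith
  intro x y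
  have h := key y x
  rw [abs_sub_comm y x] at h
  exact abs_sub_le_iff.2 ⟨by linarith [key x y], by linarith⟩

theorem monotone_parisiF (hφ : RealLipschitz L φ) (hmono : Monotone φ) (hm : 0 < m) (t : ℝ) :
    Monotone (fun x => parisiF φ m x t) := fun _ _ h =>
  parisiF_le_parisiF hφ hφ hm t fun _ => hmono (by linarith)

theorem ConvexOn.monotone_sub_translate (hconv : ConvexOn ℝ univ φ) {h : ℝ} (hh : 0 ≤ h) :
    Monotone (fun u => φ (u + h) - φ u) := by
  intro u v huv
  rcases (add_nonneg hh (sub_nonneg.2 huv)).eq_or_lt with hD | hD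
  · have : u = v := by linarith
    rw [this]
  have h1 := hconv.2 (mem_univ u) (mem_univ (v + h)) (div_nonneg (sub_nonneg.2 huv) hD.le)
    (div_nonneg hh hD.le) (by field_simp; ring)
  have h2 := hconv.2 (mem_univ u) (mem_univ (v + h)) (div_nonneg hh hD.le)
    (div_nonneg (sub_nonneg.2 huv) hD.le) (by field_simp)
  simp only [smul_eq_mul] at h1 h2
  rw [show (v - u) / (h + (v - u)) * u + h / (h + (v - u)) * (v + h) = u + h by
    field_simp; ring] at h1
  rw [show h / (h + (v - u)) * u + (v - u) / (h + (v - u)) * (v + h) = v by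
    field_simp; ring] at h2
  have e : (v - u) / (h + (v - u)) + h / (h + (v - u)) = 1 := by field_simp; ring
  have e' : (v - u) / (h + (v - u)) = 1 - h / (h + (v - u)) := by linarith
  rw [e'] at h1 h2
  change φ (u + h) - φ u ≤ φ (v + h) - φ v
  linarith

/-- Ordering of the increments of `parisiF`; `a`, `b` and `c`, `d` are the restrictions of the
two initial data to two parallel lines. -/
theorem log_integral_exp_sub_le {a b c d : ℝ → ℝ} {La Lb Lc Ld : ℝ} (hm1 : 0 < m1) (hm : m1 ≤ m2)
    (la : RealLipschitz La a) (lb : RealLipschitz Lb b) (lc : RealLipschitz Lc c)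
    (ld : RealLipschitz Ld d) (hba : Monotone (fun z => b z - a z)) (hc : Monotone c)
    (hca : Monotone (fun z => c z - a z)) (hd : ∀ z, b z - a z ≤ d z - c z) :
    1 / m1 * Real.log (∫ z, Real.exp (m1 * b z) ∂(gaussianReal 0 1))
      - 1 / m1 * Real.log (∫ z, Real.exp (m1 * a z) ∂(gaussianReal 0 1)) ≤
    1 / m2 * Real.log (∫ z, Real.exp (m2 * d z) ∂(gaussianReal 0 1))
      - 1 / m2 * Real.log (∫ z, Real.exp (m2 * c z) ∂(gaussianReal 0 1)) := by
  have hm2 : 0 < m2 := hm1.trans_le hm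
  set γ := gaussianReal 0 1
  set A := ∫ z, Real.exp (m1 * a z) ∂γ with hA
  set B := ∫ z, Real.exp (m1 * b z) ∂γ with hB
  set C := ∫ z, Real.exp (m2 * c z) ∂γ with hC
  set D := ∫ z, Real.exp (m2 * d z) ∂γ with hD
  have A0 : 0 < A := (la.const_mul m1).integral_exp_pos
  have B0 : 0 < B := (lb.const_mul m1).integral_exp_pos
  have C0 : 0 < C := (lc.const_mul m2).integral_exp_pos
  have D0 : 0 < D := (ld.const_mul m2).integral_exp_pos
  have lv := lb.sub la
  set l := 1 / m1 * Real.log B - 1 / m1 * Real.log A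
  have hl : m1 * l = Real.log B - Real.log A := by simp only [l]; field_simp
  set E := ∫ z, Real.exp (m1 * a z + m2 * (b z - a z)) ∂γ with hE
  have lE := (la.const_mul m1).add (lv.const_mul m2)
  have E0 : 0 < E := lE.integral_exp_pos
  set G := ∫ z, Real.exp (m2 * c z + m2 * (b z - a z)) ∂γ with hG
  have lG := (lc.const_mul m2).add (lv.const_mul m2)
  have G0 : 0 < G := lG.integral_exp_pos
  have hGD : G ≤ D := integral_mono lG.integrable_exp (ld.const_mul m2).integrable_exp fun z =>
    Real.exp_le_exp.2 (by
      have := mul_le_mul_of_nonneg_left (hd z) hm2.le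
      linarith)
  have hcheb : C * E ≤ G * A := by
    have e1 : ∀ z, Real.exp (m1 * a z) * Real.exp (m2 * c z - m1 * a z) = Real.exp (m2 * c z) :=
      fun z => by rw [← Real.exp_add]; congr 1; ring
    have e2 : ∀ z, Real.exp (m1 * a z) * Real.exp (m2 * (b z - a z)) =
        Real.exp (m1 * a z + m2 * (b z - a z)) := fun z => by rw [← Real.exp_add]
    have e3 : ∀ z, Real.exp (m2 * c z) * Real.exp (m2 * (b z - a z)) =
        Real.exp (m2 * c z + m2 * (b z - a z)) := fun z => by rw [← Real.exp_add]
    have h := integral_mul_integral_le_of_monotone (μ := γ)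
      (w := fun z => Real.exp (m1 * a z)) (f := fun z => Real.exp (m2 * c z - m1 * a z))
      (g := fun z => Real.exp (m2 * (b z - a z))) (fun z => (Real.exp_pos _).le)
      (fun y z hyz => Real.exp_le_exp.2 (by
        have h1 := mul_le_mul_of_nonneg_left (hca hyz) hm1.le
        have h2 := mul_le_mul_of_nonneg_left (hc hyz) (sub_nonneg.2 hm)
        simp only at h1
        linarith))
      (fun y z hyz => Real.exp_le_exp.2 (mul_le_mul_of_nonneg_left (hba hyz) hm2.le))
      (la.const_mul m1).integrable_exp
      (by simp_rw [e1]; exact (lc.const_mul m2).integrable_exp)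
      (by simp_rw [e2]; exact lE.integrable_exp)
      (by simp_rw [e1, e3]; exact lG.integrable_exp)
    simp_rw [e1, e2, e3] at h
    exact h
  have hjensen : A * Real.exp (m2 * l) ≤ E := by
    have hpt : ∀ z, (1 - m2 / m1) * Real.exp (m1 * a z)
        + m2 / m1 * (Real.exp (-(m1 * l)) * Real.exp (m1 * b z)) ≤
        Real.exp (-(m2 * l)) * Real.exp (m1 * a z + m2 * (b z - a z)) := fun z => by
      have h := one_add_mul_self_le_rpow_one_add (s := Real.exp (m1 * (b z - a z - l)) - 1)
        (by linarith [Real.exp_pos (m1 * (b z - a z - l))]) (p := m2 / m1) ((one_le_div hm1).2 hm)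
      rw [add_sub_cancel, ← Real.exp_mul,
        show m1 * (b z - a z - l) * (m2 / m1) = m2 * (b z - a z - l) by field_simp] at h
      have h' := mul_le_mul_of_nonneg_left h (Real.exp_pos (m1 * a z)).le
      have x1 : Real.exp (-(m1 * l)) * Real.exp (m1 * b z) =
          Real.exp (m1 * a z) * Real.exp (m1 * (b z - a z - l)) := by
        rw [← Real.exp_add, ← Real.exp_add]; congr 1; ring
      have x2 : Real.exp (-(m2 * l)) * Real.exp (m1 * a z + m2 * (b z - a z)) =
          Real.exp (m1 * a z) * Real.exp (m2 * (b z - a z - l)) := by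
        rw [← Real.exp_add, ← Real.exp_add]; congr 1; ring
      rw [x1, x2]
      linarith
    have i1 := (la.const_mul m1).integrable_exp.const_mul (1 - m2 / m1)
    have i2 := ((lb.const_mul m1).integrable_exp.const_mul (Real.exp (-(m1 * l)))).const_mul
      (m2 / m1)
    have h := integral_mono (i1.add i2) (lE.integrable_exp.const_mul (Real.exp (-(m2 * l)))) hpt
    change ∫ z, ((1 - m2 / m1) * Real.exp (m1 * a z)
        + m2 / m1 * (Real.exp (-(m1 * l)) * Real.exp (m1 * b z))) ∂γ ≤ _ at h
    rw [integral_add i1 i2, integral_const_mul, integral_const_mul, integral_const_mul,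
      integral_const_mul] at h
    have hb : Real.exp (-(m1 * l)) * B = A := by
      rw [hl, neg_sub, Real.exp_sub, Real.exp_log A0, Real.exp_log B0]
      field_simp
    rw [hb, Real.exp_neg] at h
    have h2 : A ≤ (Real.exp (m2 * l))⁻¹ * E := by linarith
    rwa [inv_mul_eq_div, le_div_iff₀ (Real.exp_pos _)] at h2
  have hfin : C * Real.exp (m2 * l) ≤ D := by
    have h1 : A * (C * Real.exp (m2 * l)) ≤ A * D := by
      have h1 := mul_le_mul_of_nonneg_left hjensen C0.le
      have h2 := mul_le_mul_of_nonneg_right hGD A0.le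
      linarith
    exact le_of_mul_le_mul_left h1 A0
  have h := Real.log_le_log (by positivity) hfin
  rw [Real.log_mul C0.ne' (Real.exp_pos _).ne', Real.log_exp] at h
  have : l ≤ (Real.log D - Real.log C) / m2 := by
    rw [le_div_iff₀ hm2]; linarith
  rw [sub_div] at this
  rw [one_div_mul_eq_div, one_div_mul_eq_div]
  exact this

theorem monotone_parisiF_sub (h1 : RealLipschitz L φ1) (h2 : RealLipschitz M φ2)
    (hmono : Monotone φ2) (hconv : ConvexOn ℝ univ φ1) (hsub : Monotone (fun x => φ2 x - φ1 x))
    (hm1 : 0 < m1) (hm : m1 ≤ m2) (t : ℝ) :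
    Monotone (fun x => parisiF φ2 m2 x t - parisiF φ1 m1 x t) := by
  intro x y hxy
  have hs := Real.sqrt_nonneg t
  have hline : ∀ w : ℝ, Monotone (fun z => w + Real.sqrt t * z) := fun w u v huv => by
    have := mul_le_mul_of_nonneg_left huv hs
    simpa using this
  have h := log_integral_exp_sub_le hm1 hm (h1.comp_affine x (Real.sqrt t))
    (h1.comp_affine y (Real.sqrt t)) (h2.comp_affine x (Real.sqrt t))
    (h2.comp_affine y (Real.sqrt t))
    (fun u v huv => by
      have h := (hconv.monotone_sub_translate (sub_nonneg.2 hxy)) (hline x huv)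
      simp only at h
      rwa [show ∀ z : ℝ, x + Real.sqrt t * z + (y - x) = y + Real.sqrt t * z by intro z; ring,
        show ∀ z : ℝ, x + Real.sqrt t * z + (y - x) = y + Real.sqrt t * z by intro z; ring] at h)
    (hmono.comp (hline x)) (hsub.comp (hline x)) fun z => by
      have := hsub (by linarith : x + Real.sqrt t * z ≤ y + Real.sqrt t * z)
      simp only at this
      linarith
  simp only [parisiF]
  linarith

theorem gaussianReal_map_sqrt_mul {t : ℝ} (ht : 0 ≤ t) :
    Measure.map (fun z => Real.sqrt t * z) (gaussianReal 0 1) = gaussianReal 0 t.toNNReal := by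
  rw [gaussianReal_map_const_mul]
  congr 1
  · simp
  · ext
    simp [Real.sq_sqrt ht, ht]

theorem integral_exp_mul_sqrt (hφ : RealLipschitz L φ) (m x : ℝ) {t : ℝ} (ht : 0 ≤ t) :
    ∫ z, Real.exp (m * φ (x + Real.sqrt t * z)) ∂(gaussianReal 0 1) =
      ∫ y, Real.exp (m * φ (x + y)) ∂(gaussianReal 0 t.toNNReal) := by
  have := hφ.continuous
  rw [← gaussianReal_map_sqrt_mul ht, integral_map (by fun_prop)
    (by exact Continuous.aestronglyMeasurable (by fun_prop))]

theorem parisiF_parisiF (hφ : RealLipschitz L φ) (hm : 0 < m) (x : ℝ) {s t : ℝ} (hs : 0 ≤ s)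
    (ht : 0 ≤ t) :
    parisiF (fun y => parisiF φ m y s) m x t = parisiF φ m x (t + s) := by
  have hc := hφ.continuous
  rw [parisiF]
  simp_rw [exp_mul_parisiF hφ hm]
  rw [parisiF]
  congr 2
  simp_rw [integral_exp_mul_sqrt hφ m _ hs]
  rw [integral_exp_mul_sqrt hφ m x (add_nonneg ht hs), Real.toNNReal_add ht hs]
  have hconv : gaussianReal 0 t.toNNReal ∗ gaussianReal 0 s.toNNReal
      = gaussianReal 0 (t.toNNReal + s.toNNReal) := by
    rw [gaussianReal_conv_gaussianReal, add_zero]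
  have hint : Integrable (fun y => Real.exp (m * φ (x + y)))
      (gaussianReal 0 (t.toNNReal + s.toNNReal)) := by
    rw [← Real.toNNReal_add ht hs, ← gaussianReal_map_sqrt_mul (add_nonneg ht hs),
      integrable_map_measure (by exact Continuous.aestronglyMeasurable (by fun_prop))
        (by fun_prop)]
    exact (hφ.mul_comp_affine m x _).integrable_exp
  rw [← hconv] at hint ⊢
  rw [integral_conv hint, ← gaussianReal_map_sqrt_mul ht, integral_map (by fun_prop)]
  · simp_rw [add_assoc]
  · have hF := (hφ.parisiF hm s).continuous
    simp_rw [← add_assoc, ← integral_exp_mul_sqrt hφ m _ hs, ← exp_mul_parisiF hφ hm]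
    exact Continuous.aestronglyMeasurable (by fun_prop)

theorem integral_sq_sub_integral_le (h1 : RealLipschitz L φ1) (h2 : RealLipschitz M φ2)
    (hmono : Monotone φ1) (hsub : Monotone (fun x => φ2 x - φ1 x)) :
    ∫ z, (φ1 z - ∫ y, φ1 y ∂(gaussianReal 0 1)) ^ 2 ∂(gaussianReal 0 1) ≤
      ∫ z, (φ2 z - ∫ y, φ2 y ∂(gaussianReal 0 1)) ^ 2 ∂(gaussianReal 0 1) := by
  set γ := gaussianReal 0 1
  set c1 := ∫ y, φ1 y ∂γ with hc1
  set c2 := ∫ y, φ2 y ∂γ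
  have l1 := h1.sub_const c1
  have ld := (h2.sub_const c2).sub l1
  have hcov := integral_mul_integral_le_of_monotone (μ := γ) (w := fun _ => 1)
    (f := fun z => φ1 z - c1) (g := fun z => φ2 z - c2 - (φ1 z - c1)) (fun _ => zero_le_one)
    (fun y z hyz => by simpa using hmono hyz)
    (fun y z hyz => by
      have := hsub hyz
      simp only at this ⊢
      linarith)
    (integrable_const _) (by simpa using l1.integrable) (by simpa using ld.integrable)
    (by simpa using l1.integrable_mul ld)
  have e1 : ∫ z, (φ1 z - c1) ∂γ = 0 := by
    rw [integral_sub h1.integrable (integrable_const _), ← hc1]; simp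
  simp only [one_mul, e1, zero_mul, integral_const, probReal_univ, smul_eq_mul, mul_one] at hcov
  have h : ∫ z, ((φ1 z - c1) ^ 2 + 2 * ((φ1 z - c1) * (φ2 z - c2 - (φ1 z - c1)))) ∂γ
      ≤ ∫ z, (φ2 z - c2) ^ 2 ∂γ :=
    integral_mono (l1.integrable_sq.add ((l1.integrable_mul ld).const_mul 2))
      (h2.sub_const c2).integrable_sq fun z => by
        have := sq_nonneg (φ2 z - c2 - (φ1 z - c1))
        simp only
        linarith
  rw [integral_add l1.integrable_sq ((l1.integrable_mul ld).const_mul 2),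
    integral_const_mul] at h
  linarith

theorem RealLipschitz.convexCombo (h1 : RealLipschitz L φ1) (h2 : RealLipschitz L φ2) {α : ℝ}
    (hα : α ∈ Icc (0 : ℝ) 1) : RealLipschitz L (fun y => α * φ1 y + (1 - α) * φ2 y) := by
  have h := (h1.const_mul α).add (h2.const_mul (1 - α))
  rwa [abs_of_nonneg hα.1, abs_of_nonneg (sub_nonneg.2 hα.2), ← add_mul, add_sub_cancel,
    one_mul] at h

theorem weighted_integral_sq_le (h1 : RealLipschitz L φ1) (h2 : RealLipschitz L φ2)
    (hmono : Monotone φ1) (hsub : Monotone (fun x => φ2 x - φ1 x)) (hm1 : 0 < m1) (hm : m1 ≤ m2)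
    {α : ℝ} (hα : α ∈ Icc (0 : ℝ) 1) :
    (α * m1 + (1 - α) * m2) * ∫ z, (α * φ1 z + (1 - α) * φ2 z
        - ∫ y, (α * φ1 y + (1 - α) * φ2 y) ∂(gaussianReal 0 1)) ^ 2 ∂(gaussianReal 0 1) ≤
      α * (m1 * ∫ z, (φ1 z - ∫ y, φ1 y ∂(gaussianReal 0 1)) ^ 2 ∂(gaussianReal 0 1)) +
      (1 - α) * (m2 * ∫ z, (φ2 z - ∫ y, φ2 y ∂(gaussianReal 0 1)) ^ 2 ∂(gaussianReal 0 1)) := by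
  have hV := integral_sq_sub_integral_le h1 h2 hmono hsub
  have hα0 := hα.1
  have hβ := sub_nonneg.2 hα.2
  rw [integral_add (h1.integrable.const_mul _) (h2.integrable.const_mul _), integral_const_mul,
    integral_const_mul]
  set γ := gaussianReal 0 1
  set c1 := ∫ y, φ1 y ∂γ
  set c2 := ∫ y, φ2 y ∂γ
  have h : ∫ z, (α * φ1 z + (1 - α) * φ2 z - (α * c1 + (1 - α) * c2)) ^ 2 ∂γ ≤
      ∫ z, (α * (φ1 z - c1) ^ 2 + (1 - α) * (φ2 z - c2) ^ 2) ∂γ :=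
    integral_mono ((h1.convexCombo h2 hα).sub_const _).integrable_sq
      (((h1.sub_const c1).integrable_sq.const_mul _).add
        ((h2.sub_const c2).integrable_sq.const_mul _)) fun z => by
        have := mul_nonneg (mul_nonneg hα0 hβ) (sq_nonneg ((φ1 z - c1) - (φ2 z - c2)))
        simp only
        linarith
  rw [integral_add ((h1.sub_const c1).integrable_sq.const_mul _)
    ((h2.sub_const c2).integrable_sq.const_mul _), integral_const_mul, integral_const_mul] at h
  set V1 := ∫ z, (φ1 z - c1) ^ 2 ∂γ
  set V2 := ∫ z, (φ2 z - c2) ^ 2 ∂γ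
  have hn : 0 ≤ α * m1 + (1 - α) * m2 :=
    add_nonneg (mul_nonneg hα0 hm1.le) (mul_nonneg hβ (hm1.trans_le hm).le)
  have h' := mul_le_mul_of_nonneg_left h hn
  have h'' := mul_nonneg (mul_nonneg hα0 hβ) (mul_nonneg (sub_nonneg.2 hm) (sub_nonneg.2 hV))
  linarith

theorem weighted_mean_pos {α : ℝ} (hm1 : 0 < m1) (hm : m1 ≤ m2) (hα : α ∈ Icc (0 : ℝ) 1) :
    0 < α * m1 + (1 - α) * m2 := by
  have := mul_nonneg (sub_nonneg.2 hα.2) (sub_nonneg.2 hm)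
  linarith

/-- The convexity inequality over a short time, up to an error of higher order. -/
theorem exists_parisiF_convexCombo_le (hL : 0 ≤ L) (hm1 : 0 < m1) (hm : m1 ≤ m2) {α : ℝ}
    (hα : α ∈ Icc (0 : ℝ) 1) :
    ∃ C, ∀ s ∈ Icc (0 : ℝ) 1, ∀ φ1 φ2, RealLipschitz L φ1 → RealLipschitz L φ2 → Monotone φ1 →
      Monotone (fun x => φ2 x - φ1 x) → ∀ x,
      parisiF (fun y => α * φ1 y + (1 - α) * φ2 y) (α * m1 + (1 - α) * m2) x s ≤
        α * parisiF φ1 m1 x s + (1 - α) * parisiF φ2 m2 x s + C * (s * Real.sqrt s) := by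
  have hn := weighted_mean_pos hm1 hm hα
  obtain ⟨C, hC⟩ := exists_abs_log_integral_exp_sub_le hL hn
  obtain ⟨C1, hC1⟩ := exists_abs_log_integral_exp_sub_le hL hm1
  obtain ⟨C2, hC2⟩ := exists_abs_log_integral_exp_sub_le hL (hm1.trans_le hm)
  refine ⟨C + α * C1 + (1 - α) * C2, fun s hs φ1 φ2 h1 h2 hmono hsub x => ?_⟩
  have hσ := Real.sqrt_nonneg s
  have hσ1 : Real.sqrt s ≤ 1 := Real.sqrt_le_one.2 hs.2
  have hline : Monotone (fun z => x + Real.sqrt s * z) := fun u v huv => by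
    have := mul_le_mul_of_nonneg_left huv hσ
    simpa using this
  have l1 := h1.comp_affine x (Real.sqrt s)
  have l2 := h2.comp_affine x (Real.sqrt s)
  rw [abs_of_nonneg hσ] at l1 l2
  have k := (abs_le.1 (hC _ hσ hσ1 _ (l1.convexCombo l2 hα))).2
  have k1 := mul_le_mul_of_nonneg_left (abs_le.1 (hC1 _ hσ hσ1 _ l1)).1 hα.1
  have k2 := mul_le_mul_of_nonneg_left (abs_le.1 (hC2 _ hσ hσ1 _ l2)).1 (sub_nonneg.2 hα.2)
  have hV := weighted_integral_sq_le l1 l2 (hmono.comp hline) (hsub.comp hline) hm1 hm hα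
  have hE : ∫ z, (α * φ1 (x + Real.sqrt s * z) + (1 - α) * φ2 (x + Real.sqrt s * z))
      ∂(gaussianReal 0 1) = α * (∫ z, φ1 (x + Real.sqrt s * z) ∂(gaussianReal 0 1))
        + (1 - α) * ∫ z, φ2 (x + Real.sqrt s * z) ∂(gaussianReal 0 1) := by
    rw [integral_add (l1.integrable.const_mul _) (l2.integrable.const_mul _),
      integral_const_mul, integral_const_mul]
  rw [show s * Real.sqrt s = Real.sqrt s ^ 3 by
    rw [pow_succ, Real.sq_sqrt hs.1]]
  simp only [parisiF]
  linarith

theorem parisiF_convexCombo_nat_mul_le {C s α : ℝ} (hm1 : 0 < m1) (hm : m1 ≤ m2)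
    (hα : α ∈ Icc (0 : ℝ) 1) (hs : 0 ≤ s)
    (hC : ∀ φ1 φ2, RealLipschitz L φ1 → RealLipschitz L φ2 → Monotone φ1 →
      Monotone (fun x => φ2 x - φ1 x) → ∀ x,
      parisiF (fun y => α * φ1 y + (1 - α) * φ2 y) (α * m1 + (1 - α) * m2) x s ≤
        α * parisiF φ1 m1 x s + (1 - α) * parisiF φ2 m2 x s + C)
    (h1 : RealLipschitz L φ1) (h2 : RealLipschitz L φ2) (hmono1 : Monotone φ1)
    (hmono2 : Monotone φ2) (hconv : ConvexOn ℝ univ φ1)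
    (hsub : Monotone (fun x => φ2 x - φ1 x)) (k : ℕ) (x : ℝ) :
    parisiF (fun y => α * φ1 y + (1 - α) * φ2 y) (α * m1 + (1 - α) * m2) x (k * s) ≤
      α * parisiF φ1 m1 x (k * s) + (1 - α) * parisiF φ2 m2 x (k * s) + k * C := by
  have hn := weighted_mean_pos hm1 hm hα
  have hm2 := hm1.trans_le hm
  induction k generalizing x with
  | zero => simp [parisiF_zero, hn, hm1, hm2]
  | succ k ih =>
    have hks : 0 ≤ k * s := by positivity
    have p1 := h1.parisiF hm1 (k * s)
    have p2 := h2.parisiF hm2 (k * s)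
    have step := hC _ _ p1 p2 (monotone_parisiF h1 hmono1 hm1 _)
      (monotone_parisiF_sub h1 h2 hmono2 hconv hsub hm1 hm _) x
    have h := parisiF_le_parisiF ((h1.convexCombo h2 hα).parisiF hn (k * s))
      ((p1.convexCombo p2 hα).add_const (k * C)) hn (x := x) s fun z => ih _
    rw [parisiF_add_const (p1.convexCombo p2 hα) hn,
      parisiF_parisiF (h1.convexCombo h2 hα) hn x hks hs] at h
    rw [parisiF_parisiF h1 hm1 x hks hs, parisiF_parisiF h2 hm2 x hks hs] at step
    push_cast
    rw [show ((k : ℝ) + 1) * s = s + k * s by ring]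
    linarith

/-- Convexity of `parisiF` in the pair of initial datum and parameter, for Lipschitz data. -/
theorem parisiF_convexCombo_le {t α : ℝ} (hL : 0 ≤ L) (hm1 : 0 < m1) (hm : m1 ≤ m2)
    (hα : α ∈ Icc (0 : ℝ) 1) (ht : t ∈ Icc (0 : ℝ) 1)
    (h1 : RealLipschitz L φ1) (h2 : RealLipschitz L φ2) (hmono1 : Monotone φ1)
    (hmono2 : Monotone φ2) (hconv : ConvexOn ℝ univ φ1)
    (hsub : Monotone (fun x => φ2 x - φ1 x)) (x : ℝ) :
    parisiF (fun y => α * φ1 y + (1 - α) * φ2 y) (α * m1 + (1 - α) * m2) x t ≤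
      α * parisiF φ1 m1 x t + (1 - α) * parisiF φ2 m2 x t := by
  obtain ⟨C, hC⟩ := exists_parisiF_convexCombo_le hL hm1 hm hα
  set R := α * parisiF φ1 m1 x t + (1 - α) * parisiF φ2 m2 x t
  have hlim : Filter.Tendsto (fun N : ℕ => R + C * (t * Real.sqrt (t / ((N : ℝ) + 1))))
      Filter.atTop (nhds R) := by
    have h0 : Filter.Tendsto (fun N : ℕ => t / ((N : ℝ) + 1)) Filter.atTop (nhds 0) :=
      (tendsto_const_div_atTop_nhds_zero_nat t).comp (Filter.tendsto_add_atTop_nat 1) |>.congr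
        fun N => by simp
    have h := (((Real.continuous_sqrt.tendsto 0).comp h0).const_mul t).const_mul C |>.const_add R
    simpa using h
  refine ge_of_tendsto' hlim fun N => ?_
  have hN : (0 : ℝ) < (N : ℝ) + 1 := by positivity
  have hs0 : 0 ≤ t / ((N : ℝ) + 1) := div_nonneg ht.1 hN.le
  have hs1 : t / ((N : ℝ) + 1) ≤ 1 := by
    rw [div_le_one hN]
    linarith [ht.2, (Nat.cast_nonneg N : (0 : ℝ) ≤ N)]
  have h := parisiF_convexCombo_nat_mul_le hm1 hm hα hs0 (hC _ ⟨hs0, hs1⟩) h1 h2 hmono1 hmono2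
    hconv hsub (N + 1) x
  push_cast at h
  rw [mul_div_cancel₀ t hN.ne'] at h
  have e : ((N : ℝ) + 1) * (C * (t / ((N : ℝ) + 1) * Real.sqrt (t / ((N : ℝ) + 1)))) =
      C * (t * Real.sqrt (t / ((N : ℝ) + 1))) := by
    field_simp
  rwa [e] at h

end parisiF

theorem realLipschitz_of_abs_deriv_le {f : ℝ → ℝ} {C : ℝ} (hf : Differentiable ℝ f)
    (h : ∀ x, |deriv f x| ≤ C) : RealLipschitz C f := fun x y =>
  convex_univ.norm_image_sub_le_of_norm_deriv_le (fun z _ => hf z) (fun z _ => h z)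
    (mem_univ y) (mem_univ x)

theorem parisi_convexity_nondec (φ1 φ2 : ℝ → ℝ) (h : AdmissibleNondecPair φ1 φ2)
    (m1 m2 : ℝ) (hm1 : 0 < m1) (hm12 : m1 ≤ m2)
    (α : ℝ) (hα : α ∈ Set.Icc (0 : ℝ) 1) :
    ∀ x : ℝ, ∀ t ∈ Set.Icc (0 : ℝ) 1,
      parisiF (fun y => α * φ1 y + (1 - α) * φ2 y) (α * m1 + (1 - α) * m2) x t
        ≤ α * parisiF φ1 m1 x t + (1 - α) * parisiF φ2 m2 x t := by
  obtain ⟨⟨d1, -, ⟨C1, hC1⟩, -⟩, ⟨d2, -, ⟨C2, hC2⟩, -⟩, mono1, mono2, conv1, -, -, hderiv⟩ := h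
  intro x t ht
  refine parisiF_convexCombo_le (L := max C1 C2)
    ((abs_nonneg _).trans ((hC1 0).trans (le_max_left _ _))) hm1 hm12 hα ht
    (realLipschitz_of_abs_deriv_le d1 fun z => (hC1 z).trans (le_max_left _ _))
    (realLipschitz_of_abs_deriv_le d2 fun z => (hC2 z).trans (le_max_right _ _))
    mono1 mono2 conv1 (monotone_of_deriv_nonneg (d2.sub d1) fun z => ?_) x
  change 0 ≤ deriv (φ2 - φ1) z
  rw [deriv_sub (d2 z) (d1 z)]
  exact sub_nonneg.2 (hderiv z)
end

section
/- Let (φ1, φ2) be an admissible even pair and let 0 < m1 ≤ m2 be reals. Then for every t ∈ [0,1], the pair of functions x ↦ F_{φ1,m1}(x,t) and x ↦ F_{φ2,m2}(x,t) is again an admissible even pair; that is, both are twice differentiable in x with bounded first and second derivatives, even, convex, F_{φ1,m1}(x,t) ≤ F_{φ2,m2}(x,t) for all x, and ∂ₓF_{φ1,m1}(x,t) ≤ ∂ₓF_{φ2,m2}(x,t) for all x ≥ 0. -/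
open MeasureTheory ProbabilityTheory Set

/-- An admissible even pair. -/
def AdmissibleEvenPair (φ1 φ2 : ℝ → ℝ) : Prop :=
  TwiceDiffBounded φ1 ∧ TwiceDiffBounded φ2 ∧
    (∀ x, φ1 (-x) = φ1 x) ∧ (∀ x, φ2 (-x) = φ2 x) ∧
    ConvexOn ℝ Set.univ φ1 ∧ ConvexOn ℝ Set.univ φ2 ∧
    (∀ x, φ1 x ≤ φ2 x) ∧ (∀ x, 0 ≤ x → deriv φ1 x ≤ deriv φ2 x)

/-- Measurable real functions that grow at most exponentially in `|x|`. -/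
def ExpGrowth (f : ℝ → ℝ) : Prop :=
  Measurable f ∧ ∃ K L : ℝ, 0 ≤ K ∧ 0 ≤ L ∧ ∀ x, |f x| ≤ K * Real.exp (L * |x|)

namespace ExpGrowth

variable {f g : ℝ → ℝ}

lemma of_bounded (hf : Measurable f) {C : ℝ} (h : ∀ x, |f x| ≤ C) : ExpGrowth f :=
  ⟨hf, C, 0, (abs_nonneg _).trans (h 0), le_rfl, fun x => by simpa using h x⟩

lemma mul (hf : ExpGrowth f) (hg : ExpGrowth g) : ExpGrowth (fun x => f x * g x) := by
  obtain ⟨hf, K, L, hK, hL, h⟩ := hf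
  obtain ⟨hg, K', L', hK', hL', h'⟩ := hg
  refine ⟨hf.mul hg, K * K', L + L', by positivity, by positivity, fun x => ?_⟩
  calc |f x * g x| = |f x| * |g x| := abs_mul _ _
    _ ≤ (K * Real.exp (L * |x|)) * (K' * Real.exp (L' * |x|)) := by gcongr <;> simp [h, h']
    _ = _ := by rw [add_mul, Real.exp_add]; ring

lemma add (hf : ExpGrowth f) (hg : ExpGrowth g) : ExpGrowth (fun x => f x + g x) := by
  obtain ⟨hf, K, L, hK, hL, h⟩ := hf
  obtain ⟨hg, K', L', hK', hL', h'⟩ := hg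
  refine ⟨hf.add hg, K + K', L + L', by positivity, by positivity, fun x => ?_⟩
  calc |f x + g x| ≤ |f x| + |g x| := abs_add_le _ _
    _ ≤ K * Real.exp (L * |x|) + K' * Real.exp (L' * |x|) := add_le_add (h x) (h' x)
    _ ≤ K * Real.exp ((L + L') * |x|) + K' * Real.exp ((L + L') * |x|) := by
        gcongr <;> linarith
    _ = _ := by ring

lemma const (c : ℝ) : ExpGrowth (fun _ => c) := of_bounded measurable_const (fun _ => le_rfl)

lemma comp_affine (hf : ExpGrowth f) (x s : ℝ) : ExpGrowth (fun z => f (x + s * z)) := by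
  obtain ⟨hf, K, L, hK, hL, h⟩ := hf
  refine ⟨by fun_prop, K * Real.exp (L * |x|), L * |s|, by positivity, by positivity,
    fun z => (h _).trans ?_⟩
  rw [mul_assoc, ← Real.exp_add]
  gcongr
  calc L * |x + s * z| ≤ L * (|x| + |s * z|) := by gcongr; exact abs_add_le _ _
    _ = _ := by rw [abs_mul]; ring

lemma comp_mul_left (hf : ExpGrowth f) (s : ℝ) : ExpGrowth (fun z => f (s * z)) := by
  simpa using hf.comp_affine 0 s

lemma exp_mul (a : ℝ) : ExpGrowth (fun z => Real.exp (a * z)) := by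
  refine ⟨by fun_prop, 1, |a|, zero_le_one, abs_nonneg _, fun z => ?_⟩
  rw [abs_of_pos (Real.exp_pos _), one_mul, ← abs_mul]
  exact Real.exp_le_exp.2 (le_abs_self _)

lemma cosh_mul (a : ℝ) : ExpGrowth (fun z => Real.cosh (a * z)) := by
  have h := ((exp_mul a).add (exp_mul (-a))).mul (const (1 / 2))
  convert! h using 2 with z
  rw [Real.cosh_eq, neg_mul]; ring

lemma integrable (hf : ExpGrowth f) : Integrable f (gaussianReal 0 1) := by
  obtain ⟨hf, K, L, hK, hL, h⟩ := hf
  have h1 : Integrable (fun x : ℝ => Real.exp (L * |x|)) (gaussianReal 0 1) :=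
    integrable_exp_mul_abs (X := id) (integrable_exp_mul_gaussianReal L)
      (integrable_exp_mul_gaussianReal (-L))
  exact (h1.const_mul K).mono' hf.aestronglyMeasurable (ae_of_all _ h)

/-- Differentiation under a Gaussian integral. -/
lemma hasDerivAt_integral (hf : ExpGrowth f) (hd : Differentiable ℝ f)
    (hf' : ExpGrowth (deriv f)) (x s : ℝ) :
    HasDerivAt (fun x => ∫ z, f (x + s * z) ∂(gaussianReal 0 1))
      (∫ z, deriv f (x + s * z) ∂(gaussianReal 0 1)) x := by
  have hm := hf.1
  have hm' := hf'.1
  obtain ⟨-, K, L, hK, hL, h⟩ := id hf'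
  have hb : ExpGrowth (fun z => K * Real.exp (L * (|x| + 1)) * Real.exp ((L * |s|) * |z|)) := by
    refine ⟨by fun_prop, K * Real.exp (L * (|x| + 1)), L * |s|, by positivity, by positivity,
      fun z => ?_⟩
    rw [abs_of_nonneg (by positivity)]
  refine (hasDerivAt_integral_of_dominated_loc_of_deriv_le (F' := fun y z => deriv f (y + s * z))
    (Metric.ball_mem_nhds x one_pos)
    (Filter.Eventually.of_forall fun y => (hf.comp_affine y s).1.aestronglyMeasurable)
    (hf.comp_affine x s).integrable (hf'.comp_affine x s).1.aestronglyMeasurable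
    (ae_of_all _ fun z y hy => ?_) hb.integrable (ae_of_all _ fun z y _ => ?_)).2
  · refine (h _).trans ?_
    rw [mul_assoc, ← Real.exp_add]
    gcongr
    have hy' : |y| ≤ |x| + 1 := by
      rw [Metric.mem_ball, Real.dist_eq] at hy
      have := abs_add_le (y - x) x
      rw [sub_add_cancel] at this
      linarith
    calc L * |y + s * z| ≤ L * (|y| + |s * z|) := by gcongr; exact abs_add_le _ _
      _ ≤ L * ((|x| + 1) + |s| * |z|) := by rw [abs_mul]; gcongr
      _ = _ := by ring
  · exact (hd (y + s * z)).hasDerivAt.comp_add_const y (s * z)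

end ExpGrowth

/-- The shift of a standard Gaussian as an exponential tilt. -/
lemma integral_gaussianReal_add (f : ℝ → ℝ) (a : ℝ) :
    ∫ z, f (a + z) ∂(gaussianReal 0 1) =
      Real.exp (-a ^ 2 / 2) * ∫ z, f z * Real.exp (a * z) ∂(gaussianReal 0 1) := by
  rw [integral_gaussianReal_eq_integral_smul one_ne_zero,
    integral_gaussianReal_eq_integral_smul one_ne_zero, ← integral_const_mul,
    ← integral_sub_right_eq_self _ a]
  congr 1 with y
  simp only [gaussianPDFReal, smul_eq_mul, add_sub_cancel, sub_zero, NNReal.coe_one, mul_one]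
  have : Real.exp (-(y - a) ^ 2 / 2)
      = Real.exp (-a ^ 2 / 2) * Real.exp (-y ^ 2 / 2) * Real.exp (a * y) := by
    rw [← Real.exp_add, ← Real.exp_add]; ring_nf
  rw [this]; ring

lemma integral_gaussianReal_comp_neg (f : ℝ → ℝ) :
    ∫ z, f (-z) ∂(gaussianReal 0 1) = ∫ z, f z ∂(gaussianReal 0 1) := by
  have h : (gaussianReal 0 1).map (fun z : ℝ => -z) = gaussianReal 0 1 := by
    rw [gaussianReal_map_neg, neg_zero]
  conv_rhs => rw [← h]
  exact ((MeasurableEquiv.neg ℝ).measurableEmbedding.integral_map f).symm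

lemma integral_gaussianReal_symmetrize {f : ℝ → ℝ} (hf : ExpGrowth f) :
    ∫ z, f z ∂(gaussianReal 0 1) = ∫ z, (f z + f (-z)) / 2 ∂(gaussianReal 0 1) := by
  have hf' : ExpGrowth (fun z => f (-z)) := by simpa using hf.comp_mul_left (-1)
  rw [integral_div, integral_add hf.integrable hf'.integrable, integral_gaussianReal_comp_neg]
  ring

/-- Chebyshev's correlation inequality for similarly ordered `g` and `w₂ / w₁`. -/
lemma integral_mul_integral_le_of_ordered {μ : Measure ℝ} [SFinite μ] {g w₁ w₂ : ℝ → ℝ}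
    (h₁ : Integrable w₁ μ) (h₂ : Integrable w₂ μ) (hg₁ : Integrable (fun z => g z * w₁ z) μ)
    (hg₂ : Integrable (fun z => g z * w₂ z) μ)
    (h : ∀ y z, 0 ≤ (g y - g z) * (w₂ y * w₁ z - w₂ z * w₁ y)) :
    (∫ z, g z * w₁ z ∂μ) * ∫ z, w₂ z ∂μ ≤ (∫ z, g z * w₂ z ∂μ) * ∫ z, w₁ z ∂μ := by
  have hint : 0 ≤ ∫ p : ℝ × ℝ, (((g p.1 * w₂ p.1) * w₁ p.2 - (g p.1 * w₁ p.1) * w₂ p.2)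
      + (w₁ p.1 * (g p.2 * w₂ p.2) - w₂ p.1 * (g p.2 * w₁ p.2))) ∂(μ.prod μ) :=
    integral_nonneg fun p => (h p.1 p.2).trans_eq (by ring)
  have e : ∫ p : ℝ × ℝ, (((g p.1 * w₂ p.1) * w₁ p.2 - (g p.1 * w₁ p.1) * w₂ p.2)
      + (w₁ p.1 * (g p.2 * w₂ p.2) - w₂ p.1 * (g p.2 * w₁ p.2))) ∂(μ.prod μ)
      = ((∫ z, g z * w₂ z ∂μ) * (∫ z, w₁ z ∂μ) - (∫ z, g z * w₁ z ∂μ) * ∫ z, w₂ z ∂μ)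
      + ((∫ z, w₁ z ∂μ) * (∫ z, g z * w₂ z ∂μ) - (∫ z, w₂ z ∂μ) * ∫ z, g z * w₁ z ∂μ) := by
    simp only [← integral_prod_mul]
    rw [← integral_sub (hg₂.mul_prod h₁) (hg₁.mul_prod h₂),
      ← integral_sub (h₁.mul_prod hg₂) (h₂.mul_prod hg₁)]
    exact integral_add ((hg₂.mul_prod h₁).sub (hg₁.mul_prod h₂))
      ((h₁.mul_prod hg₂).sub (h₂.mul_prod hg₁))
  rw [e] at hint
  linarith

lemma monotone_tanh : Monotone Real.tanh := by
  intro a b hab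
  rw [Real.tanh_eq_sinh_div_cosh, Real.tanh_eq_sinh_div_cosh,
    div_le_div_iff₀ (Real.cosh_pos _) (Real.cosh_pos _)]
  have h : 0 ≤ Real.sinh (b - a) := Real.sinh_nonneg_iff.2 (sub_nonneg.2 hab)
  rw [Real.sinh_sub] at h
  linarith

namespace TwiceDiffBounded

variable {φ : ℝ → ℝ}

lemma expGrowth_deriv (h : TwiceDiffBounded φ) : ExpGrowth (deriv φ) := by
  obtain ⟨-, -, ⟨C, hC⟩, -⟩ := h
  exact ExpGrowth.of_bounded (measurable_deriv φ) hC

lemma expGrowth_deriv2 (h : TwiceDiffBounded φ) : ExpGrowth (deriv (deriv φ)) := by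
  obtain ⟨-, -, -, C, hC⟩ := h
  exact ExpGrowth.of_bounded (measurable_deriv _) hC

lemma expGrowth_exp (h : TwiceDiffBounded φ) {m : ℝ} (hm : 0 < m) :
    ExpGrowth (fun x => Real.exp (m * φ x)) := by
  obtain ⟨hd, -, ⟨C, hC⟩, -⟩ := h
  have hC0 : 0 ≤ C := (abs_nonneg _).trans (hC 0)
  have hφ := hd.continuous.measurable
  refine ⟨by fun_prop, Real.exp (m * |φ 0|), m * C, by positivity, by positivity, fun x => ?_⟩
  have hx : |φ x - φ 0| ≤ C * |x - 0| := by
    simpa using Convex.norm_image_sub_le_of_norm_deriv_le (s := univ) (fun y _ => hd y)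
      (fun y _ => hC y) convex_univ (mem_univ (0 : ℝ)) (mem_univ x)
  rw [abs_of_pos (Real.exp_pos _), ← Real.exp_add, Real.exp_le_exp, sub_zero] at *
  have h1 := le_abs_self (φ x - φ 0)
  have h2 := le_abs_self (φ 0)
  calc m * φ x ≤ m * (|φ 0| + C * |x|) := by gcongr; linarith
    _ = _ := by ring

lemma hasDerivAt_exp (h : TwiceDiffBounded φ) (m x : ℝ) : HasDerivAt (fun x => Real.exp (m * φ x))
    (m * (deriv φ x * Real.exp (m * φ x))) x := by
  have := ((h.1 x).hasDerivAt.const_mul m).exp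
  convert this using 1; ring

lemma hasDerivAt_deriv_mul_exp (h : TwiceDiffBounded φ) (m x : ℝ) :
    HasDerivAt (fun x => deriv φ x * Real.exp (m * φ x))
    ((deriv (deriv φ) x + m * (deriv φ x * deriv φ x)) * Real.exp (m * φ x)) x := by
  have := (h.2.1 x).hasDerivAt.mul (h.hasDerivAt_exp m x)
  convert! this using 1; ring

lemma hasDerivAt_integral_exp (h : TwiceDiffBounded φ) {m : ℝ} (hm : 0 < m) (x s : ℝ) :
    HasDerivAt (fun x => ∫ z, Real.exp (m * φ (x + s * z)) ∂(gaussianReal 0 1))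
      (m * ∫ z, deriv φ (x + s * z) * Real.exp (m * φ (x + s * z)) ∂(gaussianReal 0 1)) x := by
  have hd : deriv (fun x => Real.exp (m * φ x)) = fun x => m * (deriv φ x * Real.exp (m * φ x)) :=
    funext fun y => (h.hasDerivAt_exp m y).deriv
  have := (h.expGrowth_exp hm).hasDerivAt_integral
    (fun y => (h.hasDerivAt_exp m y).differentiableAt)
    (hd ▸ (ExpGrowth.const m).mul (h.expGrowth_deriv.mul (h.expGrowth_exp hm))) x s
  simpa only [hd, integral_const_mul] using this

lemma hasDerivAt_integral_deriv_mul_exp (h : TwiceDiffBounded φ) {m : ℝ} (hm : 0 < m) (x s : ℝ) :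
    HasDerivAt (fun x => ∫ z, deriv φ (x + s * z) * Real.exp (m * φ (x + s * z))
        ∂(gaussianReal 0 1))
      (∫ z, (deriv (deriv φ) (x + s * z) + m * (deriv φ (x + s * z) * deriv φ (x + s * z))) *
        Real.exp (m * φ (x + s * z)) ∂(gaussianReal 0 1)) x := by
  have hd : deriv (fun x => deriv φ x * Real.exp (m * φ x)) = fun x =>
      (deriv (deriv φ) x + m * (deriv φ x * deriv φ x)) * Real.exp (m * φ x) :=
    funext fun y => (h.hasDerivAt_deriv_mul_exp m y).deriv
  have := (h.expGrowth_deriv.mul (h.expGrowth_exp hm)).hasDerivAt_integral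
    (fun y => (h.hasDerivAt_deriv_mul_exp m y).differentiableAt)
    (hd ▸ (h.expGrowth_deriv2.add ((ExpGrowth.const m).mul
      (h.expGrowth_deriv.mul h.expGrowth_deriv))).mul (h.expGrowth_exp hm)) x s
  simpa only [hd] using this

lemma integral_exp_pos (h : TwiceDiffBounded φ) {m : ℝ} (hm : 0 < m) (x s : ℝ) :
    0 < ∫ z, Real.exp (m * φ (x + s * z)) ∂(gaussianReal 0 1) :=
  MeasureTheory.integral_exp_pos ((h.expGrowth_exp hm).comp_affine x s).integrable

lemma hasDerivAt_parisiF (h : TwiceDiffBounded φ) {m : ℝ} (hm : 0 < m) (x t : ℝ) :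
    HasDerivAt (fun x => parisiF φ m x t)
      ((∫ z, deriv φ (x + √t * z) * Real.exp (m * φ (x + √t * z)) ∂(gaussianReal 0 1)) /
        ∫ z, Real.exp (m * φ (x + √t * z)) ∂(gaussianReal 0 1)) x := by
  have h1 := ((h.hasDerivAt_integral_exp hm x √t).log (h.integral_exp_pos hm x √t).ne').const_mul
    (1 / m)
  refine h1.congr_deriv ?_
  field_simp

lemma deriv_parisiF (h : TwiceDiffBounded φ) {m : ℝ} (hm : 0 < m) (t : ℝ) :
    deriv (fun x => parisiF φ m x t) = fun x =>
      (∫ z, deriv φ (x + √t * z) * Real.exp (m * φ (x + √t * z)) ∂(gaussianReal 0 1)) /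
        ∫ z, Real.exp (m * φ (x + √t * z)) ∂(gaussianReal 0 1) :=
  funext fun x => (h.hasDerivAt_parisiF hm x t).deriv

/-- The second derivative of `parisiF` in space, with the variance term kept as one square. -/
lemma hasDerivAt_deriv_parisiF (h : TwiceDiffBounded φ) {m : ℝ} (hm : 0 < m) (x t : ℝ) :
    HasDerivAt (deriv (fun x => parisiF φ m x t))
      ((∫ z, (deriv (deriv φ) (x + √t * z) +
          m * (deriv φ (x + √t * z) - deriv (fun x => parisiF φ m x t) x) ^ 2) *
          Real.exp (m * φ (x + √t * z)) ∂(gaussianReal 0 1)) /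
        ∫ z, Real.exp (m * φ (x + √t * z)) ∂(gaussianReal 0 1)) x := by
  have hu := h.integral_exp_pos hm x √t
  have h1 := (h.hasDerivAt_integral_deriv_mul_exp hm x √t).div (h.hasDerivAt_integral_exp hm x √t)
    hu.ne'
  rw [h.deriv_parisiF hm t]
  refine h1.congr_deriv ?_
  have hE := (h.expGrowth_exp hm).comp_affine x √t
  have hD := h.expGrowth_deriv.comp_affine x √t
  have hD2 := h.expGrowth_deriv2.comp_affine x √t
  have i1 := ((hD2.add ((ExpGrowth.const m).mul (hD.mul hD))).mul hE).integrable
  have i2 := (hD.mul hE).integrable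
  have i3 := hE.integrable
  beta_reduce at i1 i2 i3 ⊢
  generalize hV : (∫ z, deriv φ (x + √t * z) * Real.exp (m * φ (x + √t * z))
    ∂(gaussianReal 0 1)) = V at *
  generalize hU : (∫ z, Real.exp (m * φ (x + √t * z)) ∂(gaussianReal 0 1)) = U at *
  have key : ∀ q : ℝ, ∫ z, (deriv (deriv φ) (x + √t * z) + m * (deriv φ (x + √t * z) - q) ^ 2) *
      Real.exp (m * φ (x + √t * z)) ∂(gaussianReal 0 1) =
      (∫ z, (deriv (deriv φ) (x + √t * z) + m * (deriv φ (x + √t * z) * deriv φ (x + √t * z))) *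
        Real.exp (m * φ (x + √t * z)) ∂(gaussianReal 0 1)) - 2 * m * q * V + m * q ^ 2 * U := by
    intro q
    rw [← hV, ← hU, ← integral_const_mul, ← integral_const_mul,
      ← integral_sub i1 (i2.const_mul _)]
    refine Eq.trans (integral_congr_ae (ae_of_all _ fun z => ?_))
      (integral_add (i1.sub (i2.const_mul _)) (i3.const_mul _))
    beta_reduce
    ring
  rw [key]
  field_simp
  ring

lemma abs_integral_mul_exp_div_le (h : TwiceDiffBounded φ) {m : ℝ} (hm : 0 < m) (x s : ℝ)
    {f : ℝ → ℝ} {C : ℝ} (hf : ∀ z, |f z| ≤ C) :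
    |(∫ z, f z * Real.exp (m * φ (x + s * z)) ∂(gaussianReal 0 1)) /
        ∫ z, Real.exp (m * φ (x + s * z)) ∂(gaussianReal 0 1)| ≤ C := by
  have hu := h.integral_exp_pos hm x s
  rw [abs_div, abs_of_pos hu, div_le_iff₀ hu, ← integral_const_mul,
    ← Real.norm_eq_abs]
  refine norm_integral_le_of_norm_le
    (((h.expGrowth_exp hm).comp_affine x s).integrable.const_mul C) (ae_of_all _ fun z => ?_)
  rw [Real.norm_eq_abs, abs_mul, Real.abs_exp]
  gcongr
  exact hf z

lemma twiceDiffBounded_parisiF (h : TwiceDiffBounded φ) {m : ℝ} (hm : 0 < m) (t : ℝ) :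
    TwiceDiffBounded (fun x => parisiF φ m x t) := by
  obtain ⟨C, hC⟩ := h.2.2.1
  obtain ⟨D, hD⟩ := h.2.2.2
  have hb : ∀ x, |deriv (fun x => parisiF φ m x t) x| ≤ C := fun x => by
    rw [h.deriv_parisiF hm t]
    exact h.abs_integral_mul_exp_div_le hm x _ fun z => hC _
  refine ⟨fun x => (h.hasDerivAt_parisiF hm x t).differentiableAt,
    fun x => (h.hasDerivAt_deriv_parisiF hm x t).differentiableAt, ⟨C, hb⟩,
    D + m * (C + C) ^ 2, fun x => ?_⟩
  rw [(h.hasDerivAt_deriv_parisiF hm x t).deriv]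
  refine h.abs_integral_mul_exp_div_le hm x _ fun z => (abs_add_le _ _).trans ?_
  rw [abs_mul, abs_of_pos hm, abs_pow]
  gcongr
  · exact hD _
  · exact (abs_sub _ _).trans (add_le_add (hC _) (hb x))

lemma convexOn_parisiF (h : TwiceDiffBounded φ) (hc : ConvexOn ℝ univ φ) {m : ℝ} (hm : 0 < m)
    (t : ℝ) :
    ConvexOn ℝ univ (fun x => parisiF φ m x t) := by
  have hmono : Monotone (deriv φ) := monotoneOn_univ.1 (hc.monotoneOn_deriv fun x _ => h.1 x)
  refine convexOn_univ_of_deriv2_nonneg (h.twiceDiffBounded_parisiF hm t).1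
    (h.twiceDiffBounded_parisiF hm t).2.1 fun x => ?_
  rw [Function.iterate_succ, Function.iterate_one, Function.comp_apply,
    (h.hasDerivAt_deriv_parisiF hm x t).deriv]
  refine div_nonneg (integral_nonneg fun z => ?_) (h.integral_exp_pos hm x _).le
  have := hmono.deriv_nonneg (x := x + √t * z)
  simp only [Pi.zero_apply]
  positivity

end TwiceDiffBounded

lemma parisiF_neg {φ : ℝ → ℝ} (he : ∀ x, φ (-x) = φ x) (m x t : ℝ) :
    parisiF φ m (-x) t = parisiF φ m x t := by
  unfold parisiF
  rw [← integral_gaussianReal_comp_neg]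
  congr 3 with z
  rw [← he (x + √t * z)]
  congr 3
  ring

/-- `parisiF` is monotone jointly in the function and in the parameter `m`. -/
lemma parisiF_le_parisiF_s3 {φ₁ φ₂ : ℝ → ℝ} (h₁ : TwiceDiffBounded φ₁) (h₂ : TwiceDiffBounded φ₂)
    (hle : ∀ x, φ₁ x ≤ φ₂ x) {m₁ m₂ : ℝ} (hm₁ : 0 < m₁) (hm : m₁ ≤ m₂) (x t : ℝ) :
    parisiF φ₁ m₁ x t ≤ parisiF φ₂ m₂ x t := by
  have hm₂ : 0 < m₂ := hm₁.trans_le hm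
  have hu₁ := h₁.integral_exp_pos hm₁ x √t
  have hu₂ := h₂.integral_exp_pos hm₂ x √t
  set c := parisiF φ₁ m₁ x t with hc
  have hec : Real.exp (m₁ * c) = ∫ z, Real.exp (m₁ * φ₁ (x + √t * z)) ∂(gaussianReal 0 1) := by
    rw [hc, parisiF, ← mul_assoc, mul_one_div_cancel hm₁.ne', one_mul, Real.exp_log hu₁]
  have i₁ := ((h₁.expGrowth_exp hm₁).comp_affine x √t).integrable
  have i₂ := ((h₂.expGrowth_exp hm₂).comp_affine x √t).integrable
  have hpt : ∀ z, (1 - m₂ / m₁) +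
      m₂ / m₁ * Real.exp (-(m₁ * c)) * Real.exp (m₁ * φ₁ (x + √t * z)) ≤
      Real.exp (-(m₂ * c)) * Real.exp (m₂ * φ₂ (x + √t * z)) := fun z => by
    have hB := one_add_mul_self_le_rpow_one_add (p := m₂ / m₁)
      (s := Real.exp (-(m₁ * c)) * Real.exp (m₁ * φ₁ (x + √t * z)) - 1)
      (by linarith [mul_pos (Real.exp_pos (-(m₁ * c))) (Real.exp_pos (m₁ * φ₁ (x + √t * z)))])
      ((one_le_div hm₁).2 hm)
    refine (le_of_eq (by ring)).trans (hB.trans ?_)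
    rw [add_sub_cancel, ← Real.exp_add, ← Real.exp_mul, ← Real.exp_add, Real.exp_le_exp]
    have : (-(m₁ * c) + m₁ * φ₁ (x + √t * z)) * (m₂ / m₁) =
        -(m₂ * c) + m₂ * φ₁ (x + √t * z) := by field_simp
    rw [this]
    gcongr
    exact hle _
  have hI := integral_mono (μ := gaussianReal 0 1)
    ((integrable_const _).add (i₁.const_mul _)) (i₂.const_mul _) hpt
  rw [integral_add' (integrable_const _) (i₁.const_mul _), integral_const_mul, integral_const_mul,
    ← hec, mul_assoc, ← Real.exp_add] at hI
  simp only [neg_add_cancel, Real.exp_zero, integral_const, probReal_univ, smul_eq_mul, mul_one,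
    one_mul, sub_add_cancel] at hI
  have h3 : Real.exp (m₂ * c) ≤ ∫ z, Real.exp (m₂ * φ₂ (x + √t * z)) ∂(gaussianReal 0 1) := by
    rwa [Real.exp_neg, inv_mul_eq_div, one_le_div (Real.exp_pos _)] at hI
  rw [parisiF, one_div, inv_mul_eq_div, le_div_iff₀ hm₂, mul_comm]
  exact (Real.le_log_iff_exp_le hu₂).2 h3

lemma deriv_neg_of_even {φ : ℝ → ℝ} (he : ∀ x, φ (-x) = φ x) (x : ℝ) :
    deriv φ (-x) = -deriv φ x := by
  have h := deriv_comp_neg (f := φ) (x := x)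
  simp only [he] at h
  linarith

/-- For even `φ`, a Gaussian weight centered at `s * a` turns into a `cosh` weight. -/
lemma integral_exp_even {φ : ℝ → ℝ} (h : TwiceDiffBounded φ) (he : ∀ x, φ (-x) = φ x) {m : ℝ}
    (hm : 0 < m) (a s : ℝ) :
    ∫ z, Real.exp (m * φ (s * a + s * z)) ∂(gaussianReal 0 1) =
      Real.exp (-a ^ 2 / 2) *
        ∫ z, Real.exp (m * φ (s * z)) * Real.cosh (a * z) ∂(gaussianReal 0 1) := by
  have h1 := integral_gaussianReal_add (fun y => Real.exp (m * φ (s * y))) a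
  simp only [mul_add] at h1
  rw [h1, integral_gaussianReal_symmetrize
    (((h.expGrowth_exp hm).comp_mul_left s).mul (ExpGrowth.exp_mul a))]
  congr 2 with z
  rw [mul_neg, he, mul_neg, Real.cosh_eq]
  ring

/-- For even `φ`, the odd integrand `φ'` picks up a `tanh` factor against the `cosh` weight. -/
lemma integral_deriv_mul_exp_even {φ : ℝ → ℝ} (h : TwiceDiffBounded φ) (he : ∀ x, φ (-x) = φ x)
    {m : ℝ} (hm : 0 < m) (a s : ℝ) :
    ∫ z, deriv φ (s * a + s * z) * Real.exp (m * φ (s * a + s * z)) ∂(gaussianReal 0 1) =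
      Real.exp (-a ^ 2 / 2) *
        ∫ z, (deriv φ (s * z) * Real.tanh (a * z)) *
          (Real.exp (m * φ (s * z)) * Real.cosh (a * z)) ∂(gaussianReal 0 1) := by
  have h1 := integral_gaussianReal_add
    (fun y => deriv φ (s * y) * Real.exp (m * φ (s * y))) a
  simp only [mul_add] at h1
  rw [h1, integral_gaussianReal_symmetrize
    (((h.expGrowth_deriv.mul (h.expGrowth_exp hm)).comp_mul_left s).mul (ExpGrowth.exp_mul a))]
  congr 2 with z
  have hc := (Real.cosh_pos (a * z)).ne'
  rw [mul_neg, he, mul_neg, deriv_neg_of_even he, Real.tanh_eq_sinh_div_cosh]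
  have : deriv φ (s * z) * (Real.sinh (a * z) / Real.cosh (a * z)) *
      (Real.exp (m * φ (s * z)) * Real.cosh (a * z)) =
      deriv φ (s * z) * Real.exp (m * φ (s * z)) * Real.sinh (a * z) := by field_simp
  rw [this, Real.sinh_eq]
  ring

lemma deriv_parisiF_le_deriv_parisiF {φ₁ φ₂ : ℝ → ℝ} (h : AdmissibleEvenPair φ₁ φ₂)
    {m₁ m₂ : ℝ} (hm₁ : 0 < m₁) (hm : m₁ ≤ m₂) (t : ℝ) {x : ℝ} (hx : 0 ≤ x) :
    deriv (fun x => parisiF φ₁ m₁ x t) x ≤ deriv (fun x => parisiF φ₂ m₂ x t) x := by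
  obtain ⟨h₁, h₂, e₁, e₂, c₁, c₂, -, hd⟩ := h
  have hm₂ : 0 < m₂ := hm₁.trans_le hm
  rw [h₁.deriv_parisiF hm₁ t, h₂.deriv_parisiF hm₂ t]
  beta_reduce
  rcases (Real.sqrt_nonneg t).eq_or_lt with hs | hs
  · simpa [← hs] using hd x hx
  generalize √t = s at *
  obtain ⟨a, ha, rfl⟩ : ∃ a, 0 ≤ a ∧ x = s * a := ⟨x / s, by positivity, by field_simp⟩
  have hpos₁ := h₁.integral_exp_pos hm₁ (s * a) s
  have hpos₂ := h₂.integral_exp_pos hm₂ (s * a) s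
  rw [integral_exp_even h₁ e₁ hm₁] at hpos₁ ⊢
  rw [integral_exp_even h₂ e₂ hm₂] at hpos₂ ⊢
  have hexp := Real.exp_pos (-a ^ 2 / 2)
  rw [integral_deriv_mul_exp_even h₁ e₁ hm₁, integral_deriv_mul_exp_even h₂ e₂ hm₂,
    mul_div_mul_left _ _ hexp.ne', mul_div_mul_left _ _ hexp.ne',
    div_le_div_iff₀ (pos_of_mul_pos_right hpos₁ hexp.le) (pos_of_mul_pos_right hpos₂ hexp.le)]
  have mono₂ : Monotone (deriv φ₂) := monotoneOn_univ.1 (c₂.monotoneOn_deriv fun x _ => h₂.1 x)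
  have nonneg₁ : ∀ y, 0 ≤ y → 0 ≤ deriv φ₁ y := fun y hy => by
    have mono₁ : Monotone (deriv φ₁) := monotoneOn_univ.1 (c₁.monotoneOn_deriv fun x _ => h₁.1 x)
    have h0 := deriv_neg_of_even e₁ 0
    rw [neg_zero] at h0
    linarith [mono₁ hy]
  have tanh_nonneg : ∀ z, 0 ≤ z → 0 ≤ Real.tanh (a * z) := fun z hz => by
    simpa using monotone_tanh (mul_nonneg ha hz)
  have tanh_growth : ExpGrowth (fun z => Real.tanh (a * z)) :=
    ExpGrowth.of_bounded (C := 1) (monotone_tanh.measurable.comp (measurable_const_mul a))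
      fun z => (Real.abs_tanh_lt_one _).le
  have w₁ := ((h₁.expGrowth_exp hm₁).comp_mul_left s).mul (ExpGrowth.cosh_mul a)
  have w₂ := ((h₂.expGrowth_exp hm₂).comp_mul_left s).mul (ExpGrowth.cosh_mul a)
  have g₁ := (h₁.expGrowth_deriv.comp_mul_left s).mul tanh_growth
  have g₂ := (h₂.expGrowth_deriv.comp_mul_left s).mul tanh_growth
  have g_abs : ∀ φ : ℝ → ℝ, (∀ x, φ (-x) = φ x) → ∀ z,
      deriv φ (s * z) * Real.tanh (a * z) = deriv φ (s * |z|) * Real.tanh (a * |z|) := by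
    intro φ he z
    rcases abs_choice z with hz | hz <;> rw [hz]
    rw [mul_neg, mul_neg, deriv_neg_of_even he, Real.tanh_neg, neg_mul_neg]
  have φ_abs : ∀ φ : ℝ → ℝ, (∀ x, φ (-x) = φ x) → ∀ z, φ (s * z) = φ (s * |z|) := by
    intro φ he z
    rcases abs_choice z with hz | hz <;> rw [hz]
    rw [mul_neg, he]
  have g_mono : ∀ y z, |y| ≤ |z| →
      deriv φ₂ (s * y) * Real.tanh (a * y) ≤ deriv φ₂ (s * z) * Real.tanh (a * z) := by
    intro y z hyz
    rw [g_abs φ₂ e₂ y, g_abs φ₂ e₂ z]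
    have hsz : 0 ≤ s * |z| := by positivity
    exact mul_le_mul (mono₂ (by gcongr)) (monotone_tanh (by gcongr))
      (tanh_nonneg _ (abs_nonneg _)) ((nonneg₁ _ hsz).trans (hd _ hsz))
  have ψ_mono : ∀ y z, |y| ≤ |z| → m₂ * φ₂ (s * y) + m₁ * φ₁ (s * z) ≤
      m₂ * φ₂ (s * z) + m₁ * φ₁ (s * y) := by
    have hψ : ∀ x, HasDerivAt (fun x => m₂ * φ₂ x - m₁ * φ₁ x)
        (m₂ * deriv φ₂ x - m₁ * deriv φ₁ x) x := fun x =>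
      ((h₂.1 x).hasDerivAt.const_mul m₂).sub ((h₁.1 x).hasDerivAt.const_mul m₁)
    have hmono : MonotoneOn (fun x => m₂ * φ₂ x - m₁ * φ₁ x) (Ici 0) := by
      refine monotoneOn_of_deriv_nonneg (convex_Ici 0)
        (fun x _ => (hψ x).continuousAt.continuousWithinAt)
        (fun x _ => (hψ x).differentiableAt.differentiableWithinAt) fun x hx => ?_
      rw [interior_Ici, mem_Ioi] at hx
      rw [(hψ x).deriv, sub_nonneg]
      exact mul_le_mul hm (hd x hx.le) (nonneg₁ x hx.le) hm₂.le
    intro y z hyz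
    rw [φ_abs φ₂ e₂ y, φ_abs φ₂ e₂ z, φ_abs φ₁ e₁ y, φ_abs φ₁ e₁ z]
    have := hmono (a := s * |y|) (b := s * |z|) (mem_Ici.2 (by positivity))
      (mem_Ici.2 (by positivity)) (by gcongr)
    beta_reduce at this
    linarith
  have w_mono : ∀ y z, |y| ≤ |z| →
      Real.exp (m₂ * φ₂ (s * y)) * Real.cosh (a * y) *
        (Real.exp (m₁ * φ₁ (s * z)) * Real.cosh (a * z)) ≤
      Real.exp (m₂ * φ₂ (s * z)) * Real.cosh (a * z) *
        (Real.exp (m₁ * φ₁ (s * y)) * Real.cosh (a * y)) := by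
    intro y z hyz
    have hψ := Real.exp_le_exp.2 (ψ_mono y z hyz)
    rw [Real.exp_add, Real.exp_add] at hψ
    have hcc := mul_pos (Real.cosh_pos (a * y)) (Real.cosh_pos (a * z))
    linarith [mul_le_mul_of_nonneg_right hψ hcc.le]
  refine le_trans ?_ (integral_mul_integral_le_of_ordered w₁.integrable w₂.integrable
    (g₂.mul w₁).integrable (g₂.mul w₂).integrable fun y z => ?_)
  · refine mul_le_mul_of_nonneg_right ?_ (pos_of_mul_pos_right hpos₂ hexp.le).le
    refine integral_mono (g₁.mul w₁).integrable (g₂.mul w₁).integrable fun z => ?_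
    beta_reduce
    rw [g_abs φ₁ e₁ z, g_abs φ₂ e₂ z]
    have := Real.cosh_pos (a * z)
    have := tanh_nonneg _ (abs_nonneg z)
    gcongr
    exact hd _ (by positivity)
  · rcases le_total |y| |z| with hyz | hyz
    · exact mul_nonneg_of_nonpos_of_nonpos (sub_nonpos.2 (g_mono y z hyz))
        (sub_nonpos.2 (w_mono y z hyz))
    · exact mul_nonneg (sub_nonneg.2 (g_mono z y hyz)) (sub_nonneg.2 (w_mono z y hyz))

theorem parisi_preserves_even_pair (φ1 φ2 : ℝ → ℝ) (h : AdmissibleEvenPair φ1 φ2)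
    (m1 m2 : ℝ) (hm1 : 0 < m1) (hm12 : m1 ≤ m2) :
    ∀ t ∈ Set.Icc (0 : ℝ) 1,
      AdmissibleEvenPair (fun x => parisiF φ1 m1 x t) (fun x => parisiF φ2 m2 x t) := by
  intro t _
  have hm2 : 0 < m2 := hm1.trans_le hm12
  obtain ⟨h1, h2, e1, e2, c1, c2, hle, -⟩ := id h
  exact ⟨h1.twiceDiffBounded_parisiF hm1 t, h2.twiceDiffBounded_parisiF hm2 t,
    fun x => parisiF_neg e1 m1 x t, fun x => parisiF_neg e2 m2 x t,
    h1.convexOn_parisiF c1 hm1 t, h2.convexOn_parisiF c2 hm2 t,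
    fun x => parisiF_le_parisiF_s3 h1 h2 hle hm1 hm12 x t,
    fun _ hx => deriv_parisiF_le_deriv_parisiF h hm1 hm12 t hx⟩
end

section
/- Let φ : ℝ → ℝ be twice differentiable with bounded first and second derivatives, nondecreasing and convex, and let x ∈ ℝ. Then the function m ↦ (1/m)·log E[exp(m·φ(x + Z))] is convex on the interval (0,1]. -/
open MeasureTheory ProbabilityTheory Set

/-- The lower-tail integral of an integrable continuous function is an antiderivative of it. -/
lemma hasDerivAt_setIntegral_Iic {p : ℝ → ℝ} (hc : Continuous p) (hi : Integrable p) (y : ℝ) :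
    HasDerivAt (fun t => ∫ z in Iic t, p z) (p y) y := by
  have h : (fun t => ∫ z in Iic t, p z) = fun t => (∫ z in Iic 0, p z) + ∫ z in (0 : ℝ)..t, p z := by
    funext t
    rw [← intervalIntegral.integral_Iic_sub_Iic hi.integrableOn hi.integrableOn]
    ring
  rw [h]
  exact (intervalIntegral.integral_hasDerivAt_right (hc.intervalIntegrable _ _)
    (hc.stronglyMeasurableAtFilter _ _) hc.continuousAt).const_add _

lemma setIntegral_pos_of_forall_mem_pos {p : ℝ → ℝ} {s : Set ℝ} (hs : MeasurableSet s)
    (hv : volume s ≠ 0) (hi : IntegrableOn p s) (hp : ∀ x ∈ s, 0 < p x) :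
    0 < ∫ z in s, p z := by
  rw [setIntegral_pos_iff_support_of_nonneg_ae _ hi]
  · refine (pos_iff_ne_zero.2 hv).trans_le (measure_mono fun x hx => ⟨(hp x hx).ne', hx⟩)
  · exact (ae_restrict_iff' hs).2 (ae_of_all _ fun x hx => (hp x hx).le)

lemma setIntegral_lt_setIntegral_of_forall_mem_lt {p q : ℝ → ℝ} {s : Set ℝ} (hs : MeasurableSet s)
    (hv : volume s ≠ 0) (hp : IntegrableOn p s) (hq : IntegrableOn q s)
    (hpq : ∀ x ∈ s, p x < q x) : ∫ z in s, p z < ∫ z in s, q z := by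
  have h := setIntegral_pos_of_forall_mem_pos hs hv (hq.sub hp)
    (fun x hx => by simpa using hpq x hx)
  simp only [Pi.sub_apply] at h
  rw [integral_sub hq hp] at h
  linarith

/-- A continuous positive probability density has a distribution function that is a bijection
onto `(0, 1)`; its inverse is differentiable. -/
lemma exists_quantile {p : ℝ → ℝ} (hc : Continuous p) (hi : Integrable p) (hpos : ∀ x, 0 < p x)
    (h1 : ∫ x, p x = 1) :
    ∃ Q : ℝ → ℝ, ∀ t ∈ Ioo (0 : ℝ) 1,
      ∫ z in Iic (Q t), p z = t ∧ HasDerivAt Q (p (Q t))⁻¹ t := by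
  set P : ℝ → ℝ := fun t => ∫ z in Iic t, p z with hP
  have hd := hasDerivAt_setIntegral_Iic hc hi
  have hPc : Continuous P := continuous_iff_continuousAt.2 fun y => (hd y).continuousAt
  have hmono : StrictMono P := strictMono_of_hasDerivAt_pos hd hpos
  have htop : Filter.Tendsto P Filter.atTop (nhds 1) := by
    rw [← h1]
    exact (aecover_Iic Filter.tendsto_id).integral_tendsto_of_countably_generated hi
  have hbot : Filter.Tendsto P Filter.atBot (nhds 0) := by
    have h2 : Filter.Tendsto (fun t => 1 - ∫ z in Ioi t, p z) Filter.atBot (nhds (1 - 1)) := by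
      refine tendsto_const_nhds.sub ?_
      rw [← h1]
      exact (aecover_Ioi Filter.tendsto_id).integral_tendsto_of_countably_generated hi
    rw [sub_self] at h2
    refine h2.congr fun t => ?_
    have := intervalIntegral.integral_Iic_add_Ioi (b := t) hi.integrableOn hi.integrableOn
    rw [h1] at this
    simp only [hP]
    linarith
  have hex : ∀ t : ℝ, ∃ s, t ∈ Ioo (0 : ℝ) 1 → P s = t := by
    intro t
    by_cases ht : t ∈ Ioo (0 : ℝ) 1
    · obtain ⟨a, ha⟩ := (hbot.eventually_lt_const ht.1).exists
      obtain ⟨b, hb⟩ := (htop.eventually_const_lt ht.2).exists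
      obtain ⟨s, hs⟩ := mem_range_of_exists_le_of_exists_ge hPc ⟨a, ha.le⟩ ⟨b, hb.le⟩
      exact ⟨s, fun _ => hs⟩
    · exact ⟨0, fun h => absurd h ht⟩
  choose Q hQ using hex
  refine ⟨Q, fun t ht => ⟨hQ t ht, ?_⟩⟩
  have hnear : ∀ᶠ u in nhds t, u ∈ Ioo (0 : ℝ) 1 := isOpen_Ioo.mem_nhds ht
  refine HasDerivAt.of_local_left_inverse (f := P) ?_ (hd (Q t)) (hpos _).ne' ?_
  · refine tendsto_order.2 ⟨fun a ha => ?_, fun b hb => ?_⟩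
    · have h3 := hmono ha
      rw [hQ t ht] at h3
      filter_upwards [hnear, lt_mem_nhds h3] with u hu hau
      rw [← hQ u hu] at hau
      exact hmono.lt_iff_lt.1 hau
    · have h3 := hmono hb
      rw [hQ t ht] at h3
      filter_upwards [hnear, gt_mem_nhds h3] with u hu hau
      rw [← hQ u hu] at hau
      exact hmono.lt_iff_lt.1 hau
  · filter_upwards [hnear] with u hu using hQ u hu

/-- If a density is log-convex relative to another one and both give the same mass to the half
lines below `y` and `s`, then at these points the first density is at most the second one. -/
lemma density_le_of_setIntegral_Iic_eq {p g q : ℝ → ℝ} (hp : Integrable p) (hg : Integrable g)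
    (hpg : ∫ x, p x = ∫ x, g x) {y s : ℝ} (hq : ConvexOn ℝ univ q)
    (hqp : ∀ x, 0 < q x ↔ g (x - y + s) < p x)
    (h : ∫ z in Iic y, p z = ∫ z in Iic s, g z) : p y ≤ g s := by
  by_contra! hlt
  have hy : 0 < q y := by rw [hqp]; simpa using hlt
  have hshift : MeasurePreserving (fun x : ℝ => x + (s - y)) volume volume :=
    measurePreserving_add_right volume (s - y)
  have hemb : MeasurableEmbedding (fun x : ℝ => x + (s - y)) :=
    measurableEmbedding_addRight (s - y)
  have hgs : Integrable (fun x => g (x - y + s)) := by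
    convert hg.comp_add_right (s - y) using 3
    ring
  have hIic : ∫ x in Iic y, g (x - y + s) = ∫ x in Iic s, g x := by
    rw [← hshift.setIntegral_preimage_emb hemb g (Iic s)]
    congr 1
    · congr 1; ext x; simp
    · ext x; congr 1; ring
  have hIoi : ∫ x in Ioi y, g (x - y + s) = ∫ x in Ioi s, g x := by
    rw [← hshift.setIntegral_preimage_emb hemb g (Ioi s)]
    congr 1
    · congr 1; ext x; simp
    · ext x; congr 1; ring
  have h' : ∫ z in Ioi y, p z = ∫ z in Ioi s, g z := by
    have e1 := intervalIntegral.integral_Iic_add_Ioi (b := y) hp.integrableOn hp.integrableOn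
    have e2 := intervalIntegral.integral_Iic_add_Ioi (b := s) hg.integrableOn hg.integrableOn
    linarith
  by_cases hr : ∀ x ∈ Ioi y, 0 < q x
  · have := setIntegral_lt_setIntegral_of_forall_mem_lt measurableSet_Ioi (by simp)
      hgs.integrableOn hp.integrableOn fun x hx => (hqp x).1 (hr x hx)
    linarith
  by_cases hl : ∀ x ∈ Iic y, 0 < q x
  · have := setIntegral_lt_setIntegral_of_forall_mem_lt measurableSet_Iic (by simp)
      hgs.integrableOn hp.integrableOn fun x hx => (hqp x).1 (hl x hx)
    linarith
  push Not at hr hl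
  obtain ⟨b, hb, hqb⟩ := hr
  obtain ⟨a, ha, hqa⟩ := hl
  have := hq.le_max_of_mem_Icc (mem_univ a) (mem_univ b) ⟨ha, (mem_Ioi.1 hb).le⟩
  exact absurd (this.trans (max_le hqa hqb)) (not_le.2 hy)

/-- The function `m ↦ log (1 + m w) / m` is convex. -/
lemma log_one_add_mul_div_le {w m n a b : ℝ} (hw : 0 ≤ w) (hm : 0 < m) (hn : 0 < n)
    (ha : 0 < a) (hb : 0 < b) (hab : a + b = 1) :
    Real.log (1 + (a * m + b * n) * w) / (a * m + b * n) ≤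
      a * (Real.log (1 + m * w) / m) + b * (Real.log (1 + n * w) / n) := by
  have hcont : ∀ r : ℝ, 0 < r → ContinuousOn (fun t : ℝ => w * (1 + t * (r * w))⁻¹) (uIcc 0 1) := by
    intro r hr
    refine continuousOn_const.mul (ContinuousOn.inv₀ (by fun_prop) fun t ht => ?_)
    rw [uIcc_of_le zero_le_one] at ht
    have := mul_nonneg ht.1 (mul_nonneg hr.le hw)
    positivity
  have key : ∀ r : ℝ, 0 < r →
      Real.log (1 + r * w) / r = ∫ t in (0 : ℝ)..1, w * (1 + t * (r * w))⁻¹ := by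
    intro r hr
    rw [intervalIntegral.integral_eq_sub_of_hasDerivAt
      (f := fun t => Real.log (1 + t * (r * w)) / r) _ (hcont r hr).intervalIntegrable]
    · simp
    · intro t ht
      rw [uIcc_of_le zero_le_one] at ht
      have h0 := mul_nonneg ht.1 (mul_nonneg hr.le hw)
      have h1 : 1 + t * (r * w) ≠ 0 := by positivity
      have := ((((hasDerivAt_id t).mul_const (r * w)).const_add 1).log h1).div_const r
      refine this.congr_deriv ?_
      rw [id_eq]
      field_simp
  have hr : 0 < a * m + b * n := by positivity
  rw [key _ hr, key _ hm, key _ hn, ← intervalIntegral.integral_const_mul,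
    ← intervalIntegral.integral_const_mul, ← intervalIntegral.integral_add
      ((hcont m hm).intervalIntegrable.const_mul a) ((hcont n hn).intervalIntegrable.const_mul b)]
  refine intervalIntegral.integral_mono_on zero_le_one (hcont _ hr).intervalIntegrable
    (((hcont m hm).intervalIntegrable.const_mul a).add
      ((hcont n hn).intervalIntegrable.const_mul b)) fun t ht => ?_
  have hm' : 0 < 1 + t * (m * w) := by have := mul_nonneg ht.1 (mul_nonneg hm.le hw); positivity
  have hn' : 0 < 1 + t * (n * w) := by have := mul_nonneg ht.1 (mul_nonneg hn.le hw); positivity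
  have hinv := (convexOn_zpow (𝕜 := ℝ) (-1)).2 (mem_Ioi.2 hm') (mem_Ioi.2 hn') ha.le hb.le hab
  simp only [smul_eq_mul, zpow_neg_one] at hinv
  have e : 1 + t * ((a * m + b * n) * w) = a * (1 + t * (m * w)) + b * (1 + t * (n * w)) := by
    linear_combination (-1) * hab
  rw [e]
  nlinarith [mul_le_mul_of_nonneg_left hinv hw]

lemma gaussianPDFReal_zero_one (x : ℝ) :
    gaussianPDFReal 0 1 x = (√(2 * Real.pi))⁻¹ * Real.exp (-x ^ 2 / 2) := by
  simp [gaussianPDFReal]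

lemma continuous_gaussianPDFReal_zero_one : Continuous (gaussianPDFReal 0 1) := by
  have : gaussianPDFReal 0 1 = fun x => (√(2 * Real.pi))⁻¹ * Real.exp (-x ^ 2 / 2) :=
    funext gaussianPDFReal_zero_one
  rw [this]
  fun_prop

/-- The monotone transport of a log-convex perturbation of the standard Gaussian law to the
standard Gaussian law is a contraction. -/
lemma exists_contracting_transport {f : ℝ → ℝ} (hf : Continuous f) (hconv : ConvexOn ℝ univ f)
    (hi : Integrable fun y => Real.exp (f y) * gaussianPDFReal 0 1 y) :
    ∃ S S' : ℝ → ℝ, ∀ y, HasDerivAt S (S' y) y ∧ 0 < S' y ∧ S' y ≤ 1 ∧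
      gaussianPDFReal 0 1 (S y) * S' y = Real.exp (f y) * gaussianPDFReal 0 1 y /
        ∫ z, Real.exp (f z) * gaussianPDFReal 0 1 z := by
  set g := gaussianPDFReal 0 1 with hg
  have hgpos : ∀ x, 0 < g x := fun x => gaussianPDFReal_pos 0 1 x one_ne_zero
  have hgc : Continuous g := continuous_gaussianPDFReal_zero_one
  have hgi : Integrable g := integrable_gaussianPDFReal 0 1
  have hg1 : ∫ x, g x = 1 := integral_gaussianPDFReal_eq_one 0 one_ne_zero
  set A := ∫ z, Real.exp (f z) * g z with hA
  have hApos : 0 < A := by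
    rw [hA, ← setIntegral_univ]
    exact setIntegral_pos_of_forall_mem_pos MeasurableSet.univ (by simp) hi.integrableOn
      fun x _ => mul_pos (Real.exp_pos _) (hgpos x)
  set p : ℝ → ℝ := fun y => Real.exp (f y) * g y / A with hp
  have hppos : ∀ x, 0 < p x := fun x => div_pos (mul_pos (Real.exp_pos _) (hgpos x)) hApos
  have hpc : Continuous p := by fun_prop
  have hpi : Integrable p := hi.div_const A
  have hp1 : ∫ x, p x = 1 := by
    rw [hp, integral_div, ← hA, div_self hApos.ne']
  obtain ⟨Q, hQ⟩ := exists_quantile hgc hgi hgpos hg1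
  set P : ℝ → ℝ := fun y => ∫ z in Iic y, p z with hP
  have hP01 : ∀ y, P y ∈ Ioo (0 : ℝ) 1 := by
    intro y
    have h1 := setIntegral_pos_of_forall_mem_pos (measurableSet_Iic (a := y)) (by simp)
      hpi.integrableOn fun x _ => hppos x
    have h2 := setIntegral_pos_of_forall_mem_pos (measurableSet_Ioi (a := y)) (by simp)
      hpi.integrableOn fun x _ => hppos x
    have h3 := intervalIntegral.integral_Iic_add_Ioi (b := y) hpi.integrableOn hpi.integrableOn
    rw [hp1] at h3
    exact ⟨h1, by simp only [hP]; linarith⟩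
  refine ⟨fun y => Q (P y), fun y => (g (Q (P y)))⁻¹ * p y, fun y => ⟨?_, ?_, ?_, ?_⟩⟩
  · exact (hQ _ (hP01 y)).2.comp y (hasDerivAt_setIntegral_Iic hpc hpi y)
  · exact mul_pos (inv_pos.2 (hgpos _)) (hppos y)
  · rw [inv_mul_le_iff₀ (hgpos _), mul_one]
    set s := Q (P y) with hs
    refine density_le_of_setIntegral_Iic_eq hpi hgi (hp1.trans hg1.symm)
      (q := fun x => f x + ((s - y) * x + ((s - y) ^ 2 / 2 - Real.log A))) ?_ ?_
      (hQ _ (hP01 y)).1.symm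
    · refine hconv.add ⟨convex_univ, fun u _ v _ a b _ _ hab => le_of_eq ?_⟩
      simp only [smul_eq_mul]
      linear_combination (-((s - y) ^ 2 / 2 - Real.log A)) * hab
    · intro x
      have hc : 0 < (√(2 * Real.pi))⁻¹ := by positivity
      have e : p x = (√(2 * Real.pi))⁻¹ * Real.exp (f x + -x ^ 2 / 2 - Real.log A) := by
        rw [Real.exp_sub, Real.exp_add, Real.exp_log hApos]
        simp only [hp, hg, gaussianPDFReal_zero_one]
        ring
      rw [e, hg, gaussianPDFReal_zero_one, mul_lt_mul_iff_right₀ hc, Real.exp_lt_exp,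
        ← sub_pos (b := -(x - y + s) ^ 2 / 2)]
      ring_nf
  · rw [mul_inv_cancel_left₀ (hgpos _).ne']

/-- A change of variables by an increasing map does not increase the integral of a nonnegative
function. -/
lemma integral_comp_mul_deriv_le {h R R' : ℝ → ℝ} (hh : Integrable h) (h0 : ∀ x, 0 ≤ h x)
    (hR : ∀ x, HasDerivAt R (R' x) x) (hpos : ∀ x, 0 < R' x) :
    Integrable (fun x => R' x * h (R x)) ∧ ∫ x, R' x * h (R x) ≤ ∫ x, h x := by
  have hinj : InjOn R univ := (strictMono_of_hasDerivAt_pos hR hpos).injective.injOn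
  have hR' : ∀ x ∈ (univ : Set ℝ), HasDerivWithinAt R (R' x) univ x :=
    fun x _ => (hR x).hasDerivWithinAt
  have e : ∀ x, |R' x| • h (R x) = R' x * h (R x) := fun x => by
    rw [abs_of_pos (hpos x), smul_eq_mul]
  have h1 := integrableOn_image_iff_integrableOn_abs_deriv_smul MeasurableSet.univ hR' hinj h
  have h2 := integral_image_eq_integral_abs_deriv_smul MeasurableSet.univ hR' hinj h
  simp only [e, integrableOn_univ, setIntegral_univ] at h1 h2
  exact ⟨h1.1 hh.integrableOn, h2 ▸ setIntegral_le_integral hh (ae_of_all _ h0)⟩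

/-- Logarithmic Hölder inequality: a pointwise lower bound on a combination of two functions
bounds the same combination of their normalized log-moment functionals. -/
lemma le_add_log_integral_exp {k₁ k₂ p : ℝ → ℝ} {m n a b A B F : ℝ} (hm : 0 < m) (hn : 0 < n)
    (ha : 0 < a) (hb : 0 < b) (hA : 0 < A) (hB : 0 < B)
    (hp0 : ∀ x, 0 ≤ p x) (hpi : Integrable p) (hp : ∫ x, p x = 1)
    (hi₁ : Integrable fun x => Real.exp (m * k₁ x) * p x)
    (hi₂ : Integrable fun x => Real.exp (n * k₂ x) * p x)
    (h₁ : ∫ x, Real.exp (m * k₁ x) * p x ≤ A) (h₂ : ∫ x, Real.exp (n * k₂ x) * p x ≤ B)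
    (hF : ∀ x, F ≤ a * k₁ x + b * k₂ x) :
    F ≤ a * (Real.log A / m) + b * (Real.log B / n) := by
  set r := (a / m + b / n)⁻¹ with hr
  have hrpos : 0 < r := by positivity
  set l₁ := r * (a / m) with hl₁
  set l₂ := r * (b / n) with hl₂
  have hl₁0 : 0 ≤ l₁ := by positivity
  have hl₂0 : 0 ≤ l₂ := by positivity
  have hl : l₁ + l₂ = 1 := by
    rw [hl₁, hl₂, ← mul_add, hr, inv_mul_cancel₀ (by positivity)]
  set G := F - (a * (Real.log A / m) + b * (Real.log B / n)) with hG
  have hpt : ∀ x, Real.exp (r * G) * p x ≤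
      l₁ / A * (Real.exp (m * k₁ x) * p x) + l₂ / B * (Real.exp (n * k₂ x) * p x) := by
    intro x
    have hexp := convexOn_exp.2 (mem_univ (m * k₁ x - Real.log A))
      (mem_univ (n * k₂ x - Real.log B)) hl₁0 hl₂0 hl
    simp only [smul_eq_mul, Real.exp_sub, Real.exp_log hA, Real.exp_log hB] at hexp
    have hle : r * G ≤ l₁ * (m * k₁ x - Real.log A) + l₂ * (n * k₂ x - Real.log B) := by
      have e : l₁ * (m * k₁ x - Real.log A) + l₂ * (n * k₂ x - Real.log B) =
          r * (a * k₁ x + b * k₂ x - (a * (Real.log A / m) + b * (Real.log B / n))) := by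
        rw [hl₁, hl₂]; field_simp; ring
      rw [e, hG]
      exact mul_le_mul_of_nonneg_left (by linarith [hF x]) hrpos.le
    calc Real.exp (r * G) * p x
        ≤ (l₁ * (Real.exp (m * k₁ x) / A) + l₂ * (Real.exp (n * k₂ x) / B)) * p x :=
          mul_le_mul_of_nonneg_right ((Real.exp_le_exp.2 hle).trans hexp) (hp0 x)
      _ = _ := by ring
  have hint := integral_mono (hpi.const_mul _)
    ((hi₁.const_mul (l₁ / A)).add (hi₂.const_mul (l₂ / B))) hpt
  rw [integral_const_mul, hp, mul_one] at hint
  simp only [Pi.add_apply] at hint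
  rw [integral_add (hi₁.const_mul _) (hi₂.const_mul _), integral_const_mul,
    integral_const_mul] at hint
  have h3 : l₁ / A * ∫ x, Real.exp (m * k₁ x) * p x ≤ l₁ := by
    calc _ ≤ l₁ / A * A := mul_le_mul_of_nonneg_left h₁ (by positivity)
      _ = l₁ := div_mul_cancel₀ _ hA.ne'
  have h4 : l₂ / B * ∫ x, Real.exp (n * k₂ x) * p x ≤ l₂ := by
    calc _ ≤ l₂ / B * B := mul_le_mul_of_nonneg_left h₂ (by positivity)
      _ = l₂ := div_mul_cancel₀ _ hB.ne'
  have h5 : Real.exp (r * G) ≤ 1 := by linarith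
  have h6 : r * G ≤ 0 := Real.exp_le_one_iff.1 h5
  have h7 : G ≤ 0 := by
    by_contra! hc
    exact absurd h6 (not_le.2 (mul_pos hrpos hc))
  linarith

/-- For convex `f`, the normalized log-moment `m ↦ log (E exp (m f(Z))) / m` satisfies the convexity
inequality. Moving along the contracting transport map attached to the intermediate parameter
turns it into the pointwise convexity of the exponent `k t y` in `t`. -/
lemma log_integral_exp_mul_div_le {f : ℝ → ℝ} (hf : Continuous f) (hconv : ConvexOn ℝ univ f)
    (hi : ∀ m, Integrable fun y => Real.exp (m * f y) * gaussianPDFReal 0 1 y)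
    {m n a b : ℝ} (hm : 0 < m) (hn : 0 < n) (ha : 0 < a) (hb : 0 < b) (hab : a + b = 1) :
    Real.log (∫ y, Real.exp ((a * m + b * n) * f y) * gaussianPDFReal 0 1 y) / (a * m + b * n) ≤
      a * (Real.log (∫ y, Real.exp (m * f y) * gaussianPDFReal 0 1 y) / m) +
      b * (Real.log (∫ y, Real.exp (n * f y) * gaussianPDFReal 0 1 y) / n) := by
  set r := a * m + b * n with hr
  have hrpos : 0 < r := by positivity
  have hconv' : ConvexOn ℝ univ fun y => r * f y := hconv.smul hrpos.le
  obtain ⟨S, S', hS⟩ := exists_contracting_transport (hf.const_mul r) hconv' (hi r)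
  set g := gaussianPDFReal 0 1 with hg
  have hgpos : ∀ x, 0 < g x := fun x => gaussianPDFReal_pos 0 1 x one_ne_zero
  set A : ℝ → ℝ := fun m => ∫ y, Real.exp (m * f y) * g y with hA
  have hApos : ∀ m, 0 < A m := fun m => by
    simp only [hA]
    rw [← setIntegral_univ]
    exact setIntegral_pos_of_forall_mem_pos MeasurableSet.univ (by simp) (hi m).integrableOn
      fun x _ => mul_pos (Real.exp_pos _) (hgpos x)
  set p : ℝ → ℝ := fun y => Real.exp (r * f y) * g y / A r with hp
  have hpS : ∀ y, p y = g (S y) * S' y := fun y => (hS y).2.2.2.symm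
  set v : ℝ → ℝ := fun y => (y - S y) / r with hv
  set w : ℝ → ℝ := fun y => ((S' y)⁻¹ - 1) / r with hw
  have hw0 : ∀ y, 0 ≤ w y := fun y =>
    div_nonneg (sub_nonneg.2 (one_le_inv₀ (hS y).2.1 |>.2 (hS y).2.2.1)) hrpos.le
  set k : ℝ → ℝ → ℝ := fun t y =>
    f (S y + t * v y) - S y * v y - t * v y ^ 2 / 2 + Real.log (1 + t * w y) / t with hk
  have hchange : ∀ t, 0 < t → ∀ y, Real.exp (t * k t y) * p y =
      (S' y * (1 + t * w y)) * (Real.exp (t * f (S y + t * v y)) * g (S y + t * v y)) := by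
    intro t ht y
    have hpos : 0 < 1 + t * w y := by have := mul_nonneg ht.le (hw0 y); positivity
    have e : t * k t y = Real.log (1 + t * w y) + t * f (S y + t * v y)
        + (-(S y + t * v y) ^ 2 / 2 - -(S y) ^ 2 / 2) := by
      simp only [hk]; field_simp; ring
    rw [e, Real.exp_add, Real.exp_add, Real.exp_sub, Real.exp_log hpos, hpS, hg,
      gaussianPDFReal_zero_one, gaussianPDFReal_zero_one]
    field_simp
  have hbound : ∀ t, 0 < t → Integrable (fun y => Real.exp (t * k t y) * p y) ∧
      ∫ y, Real.exp (t * k t y) * p y ≤ A t := by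
    intro t ht
    have hR : ∀ y, HasDerivAt (fun y => S y + t * v y) (S' y * (1 + t * w y)) y := by
      intro y
      have := (hS y).1.add ((((hasDerivAt_id y).sub (hS y).1).div_const r).const_mul t)
      refine this.congr_deriv ?_
      have := (hS y).2.1.ne'
      simp only [hw]
      field_simp
    have := integral_comp_mul_deriv_le (hi t)
      (fun x => mul_nonneg (Real.exp_pos _).le (hgpos x).le) hR
      (fun y => mul_pos (hS y).2.1 (by have := mul_nonneg ht.le (hw0 y); positivity))
    simpa only [hchange t ht] using this
  have hkr : ∀ y, k r y = Real.log (A r) / r := by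
    intro y
    have h1 : S y + r * v y = y := by simp only [hv]; field_simp; ring
    have h2 : S' y * (1 + r * w y) = 1 := by
      have := (hS y).2.1.ne'
      simp only [hw]; field_simp; ring
    have h3 := hchange r hrpos y
    rw [h1, h2, one_mul, hp] at h3
    have h4 : Real.exp (r * k r y) = A r := by
      have := (hApos r).ne'
      have := (hgpos y).ne'
      field_simp at h3
      exact h3
    rw [← h4, Real.log_exp, mul_div_cancel_left₀ _ hrpos.ne']
  refine le_add_log_integral_exp (k₁ := k m) (k₂ := k n) (p := p) hm hn ha hb (hApos m) (hApos n)
    (fun x => by simp only [hp]; have := hgpos x; have := hApos r; positivity)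
    ((hi r).div_const _) ?_ (hbound m hm).1 (hbound n hn).1 (hbound m hm).2 (hbound n hn).2 ?_
  · simp only [hp]
    rw [integral_div, div_self (hApos r).ne']
  · intro y
    rw [← hkr y]
    have hfc := hconv.2 (mem_univ (S y + m * v y)) (mem_univ (S y + n * v y)) ha.le hb.le hab
    have e : a * (S y + m * v y) + b * (S y + n * v y) = S y + r * v y := by
      rw [hr]; linear_combination (S y) * hab
    simp only [smul_eq_mul, e] at hfc
    have hl := log_one_add_mul_div_le (hw0 y) hm hn ha hb hab
    rw [← hr] at hl
    have e2 : S y * v y + r * v y ^ 2 / 2 =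
        a * (S y * v y + m * v y ^ 2 / 2) + b * (S y * v y + n * v y ^ 2 / 2) := by
      rw [hr]; linear_combination (-(S y * v y)) * hab
    simp only [hk]
    linarith

lemma integrable_exp_mul_gaussianReal_of_lipschitzWith {f : ℝ → ℝ} {K : NNReal}
    (hf : LipschitzWith K f) (m : ℝ) :
    Integrable (fun z => Real.exp (m * f z)) (gaussianReal 0 1) := by
  have hbd : ∀ z, m * f z ≤ m * f 0 + |m| * K * |z| := by
    intro z
    have h1 := hf.dist_le_mul z 0
    rw [Real.dist_eq, Real.dist_eq, sub_zero] at h1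
    have h2 : m * (f z - f 0) ≤ |m| * (K * |z|) :=
      (le_abs_self _).trans ((abs_mul _ _).trans_le (mul_le_mul_of_nonneg_left h1 (abs_nonneg m)))
    linarith
  have hint := ((integrable_exp_mul_gaussianReal (μ := 0) (v := 1) (|m| * K)).add
    (integrable_exp_mul_gaussianReal (μ := 0) (v := 1) (-(|m| * K)))).const_mul
      (Real.exp (m * f 0))
  refine hint.mono' (by have := hf.continuous; fun_prop) (ae_of_all _ fun z => ?_)
  rw [Real.norm_of_nonneg (Real.exp_pos _).le]
  refine (Real.exp_le_exp.2 (hbd z)).trans ?_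
  rw [Real.exp_add]
  refine mul_le_mul_of_nonneg_left ?_ (Real.exp_pos _).le
  simp only [Pi.add_apply]
  rcases abs_cases z with ⟨h, _⟩ | ⟨h, _⟩ <;> rw [h]
  · linarith [Real.exp_pos (-(|m| * K) * z)]
  · rw [mul_neg, ← neg_mul]
    linarith [Real.exp_pos (|m| * K * z)]

lemma integrable_gaussianReal_zero_one_iff {h : ℝ → ℝ} :
    Integrable h (gaussianReal 0 1) ↔ Integrable fun z => h z * gaussianPDFReal 0 1 z := by
  rw [gaussianReal_of_var_ne_zero 0 one_ne_zero, integrable_withDensity_iff_integrable_smul'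
    (measurable_gaussianPDF 0 1) (ae_of_all _ fun _ => gaussianPDF_lt_top)]
  simp only [toReal_gaussianPDF, smul_eq_mul, mul_comm]

theorem convexity_in_m_nondec (φ : ℝ → ℝ) (hφ : TwiceDiffBounded φ)
    (hmono : Monotone φ) (hconv : ConvexOn ℝ Set.univ φ) (x : ℝ) :
    ConvexOn ℝ (Set.Ioc (0 : ℝ) 1)
      (fun m => (1 / m) * Real.log (∫ z, Real.exp (m * φ (x + z)) ∂(gaussianReal 0 1))) := by
  obtain ⟨hd, -, ⟨C, hC⟩, -⟩ := hφ
  have hlip : LipschitzWith C.toNNReal φ :=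
    lipschitzWith_of_nnnorm_deriv_le hd fun y => by
      rw [← NNReal.coe_le_coe, coe_nnnorm, Real.norm_eq_abs]
      exact (hC y).trans (Real.le_coe_toNNReal C)
  have hlip' : LipschitzWith C.toNNReal fun z => φ (x + z) := by
    simpa [Function.comp_def] using hlip.comp (isometry_add_left x).lipschitz
  have hconv' : ConvexOn ℝ univ fun z => φ (x + z) :=
    hconv.translate_right x
  have hi : ∀ m, Integrable fun z => Real.exp (m * φ (x + z)) * gaussianPDFReal 0 1 z :=
    fun m => integrable_gaussianReal_zero_one_iff.1
      (integrable_exp_mul_gaussianReal_of_lipschitzWith hlip' m)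
  refine convexOn_iff_forall_pos.2 ⟨convex_Ioc 0 1, fun m hm n hn a b ha hb hab => ?_⟩
  have key := log_integral_exp_mul_div_le hlip'.continuous hconv' hi hm.1 hn.1 ha hb hab
  simpa only [integral_gaussianReal_eq_integral_smul one_ne_zero, smul_eq_mul,
    mul_comm (gaussianPDFReal 0 1 _), one_div_mul_eq_div] using key
end
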